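/- arXiv:1705.00167 — 2 statements merged into one kernel-verified Lean document; each statement's English description precedes it below -/
import Mathlib

section
/- Let σ: 𝒜 → ℬ⁺ be a non-erasing morphism between finite alphabets such that either (i) the rank of the incidence matrix M_σ equals |𝒜|, or (ii) |𝒜| = 2, or (iii) σ is rotationally conjugate to a left permutative or right permutative morphism. Then σ is fully recognizable for aperiodic points: every aperiodic point y ∈ ℬ^ℤ has at most one centered σ-representation (k,x) with x ∈ 𝒜^ℤ. -/
open scoped BigOperators

namespace Recog

variable {A B C : Type*}

/-- A morphism assigning a word to each letter is non-erasing if every image is nonempty. -/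
def NonErasing (σ : A → List B) : Prop := ∀ a, σ a ≠ []

/-- Apply a morphism letterwise to a finite word, concatenating the images. -/
def wordApply (σ : A → List B) : List A → List B
  | [] => []
  | a :: w => σ a ++ wordApply σ w

/-- Composition of morphisms `τ ∘ σ`. -/
def comp (τ : B → List C) (σ : A → List B) : A → List C := fun a => wordApply τ (σ a)

/-- The `ℓ`-th cutting point of the representation `(0, x)`:
`|σ(x_[0,ℓ))|` for `ℓ ≥ 0` and `-|σ(x_[ℓ,0))|` for `ℓ < 0`. -/
def cut (σ : A → List B) (x : ℤ → A) (ℓ : ℤ) : ℤ :=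
  if 0 ≤ ℓ then ∑ i ∈ Finset.range ℓ.toNat, ((σ (x i)).length : ℤ)
  else -∑ i ∈ Finset.range (-ℓ).toNat, ((σ (x (-(i : ℤ) - 1))).length : ℤ)

/-- `y` is the bi-infinite image `σ(x)`, where `σ(x₀)` starts at position `0`. -/
def IsSubstPt (σ : A → List B) (x : ℤ → A) (y : ℤ → B) : Prop :=
  ∀ (ℓ : ℤ) (j : ℕ) (hj : j < (σ (x ℓ)).length),
    y (cut σ x ℓ + j) = (σ (x ℓ)).get ⟨j, hj⟩

/-- `(k, x)` is a `σ`-representation of `y`, i.e. `y = T^k σ(x)`. -/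
def IsRep (σ : A → List B) (y : ℤ → B) (k : ℤ) (x : ℤ → A) : Prop :=
  IsSubstPt σ x fun n => y (n - k)

/-- `(k, x)` is a centered `σ`-representation of `y`: `y = T^k σ(x)` with `0 ≤ k < |σ(x₀)|`. -/
def IsCenteredRep (σ : A → List B) (y : ℤ → B) (k : ℤ) (x : ℤ → A) : Prop :=
  IsRep σ y k x ∧ 0 ≤ k ∧ k < ((σ (x 0)).length : ℤ)

/-- `y` is aperiodic: `T^p y ≠ y` for all `p ≥ 1`. -/
def Aperiodic (y : ℤ → B) : Prop := ∀ p : ℕ, 1 ≤ p → (fun n => y (n + p)) ≠ y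

/-- `y` is periodic: `T^p y = y` for some `p ≥ 1`. -/
def Periodic (y : ℤ → B) : Prop := ∃ p : ℕ, 1 ≤ p ∧ (fun n => y (n + p)) = y

/-- The set of `σ`-cutting points of the representation `(k, x)`. -/
def cutSet (σ : A → List B) (x : ℤ → A) (k : ℤ) : Set ℤ :=
  {m : ℤ | ∃ ℓ : ℤ, m = cut σ x ℓ - k}

/-- `σ` is recognizable in `X`: every `y` has at most one centered `σ`-representation in `X`. -/
def RecIn (σ : A → List B) (X : Set (ℤ → A)) : Prop :=
  ∀ (y : ℤ → B) (k k' : ℤ) (x x' : ℤ → A), x ∈ X → x' ∈ X →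
    IsCenteredRep σ y k x → IsCenteredRep σ y k' x' → k = k' ∧ x = x'

/-- `σ` is recognizable in `X` for aperiodic points. -/
def RecInAp (σ : A → List B) (X : Set (ℤ → A)) : Prop :=
  ∀ y : ℤ → B, Aperiodic y → ∀ (k k' : ℤ) (x x' : ℤ → A), x ∈ X → x' ∈ X →
    IsCenteredRep σ y k x → IsCenteredRep σ y k' x' → k = k' ∧ x = x'

/-- `σ` is left permutative: the first letters of `σ a` and `σ b` differ for distinct `a, b`. -/
def LeftPermutative (σ : A → List B) : Prop :=
  ∀ a b : A, a ≠ b → (σ a).head? ≠ (σ b).head?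

/-- `σ` is right permutative: the last letters of `σ a` and `σ b` differ for distinct `a, b`. -/
def RightPermutative (σ : A → List B) : Prop :=
  ∀ a b : A, a ≠ b → (σ a).getLast? ≠ (σ b).getLast?

/-- `σ` and `σ'` are rotationally conjugate. -/
def RotConj (σ σ' : A → List B) : Prop :=
  ∃ w : List B, (∀ a, σ a ++ w = w ++ σ' a) ∨ (∀ a, w ++ σ a = σ' a ++ w)

/-- The incidence matrix of `σ`, over `ℚ`: entry `(b, a)` counts occurrences of `b` in `σ a`. -/
noncomputable def incidence (σ : A → List B) [DecidableEq B] : Matrix B A ℚ :=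
  Matrix.of fun b a => ((σ a).count b : ℚ)

/-- The finite subword `x_[i, i+m)` of a bi-infinite sequence. -/
def factor (x : ℤ → A) (i : ℤ) (m : ℕ) : List A := (List.range m).map fun j => x (i + j)

/-- The language of a bi-infinite sequence: the set of its finite subwords. -/
def lang (x : ℤ → A) : Set (List A) := {w | ∃ (i : ℤ) (m : ℕ), w = factor x i m}

/-- `σ` is injective on bi-infinite sequences. -/
def InjZ (σ : A → List B) : Prop :=
  ∀ (x x' : ℤ → A) (y : ℤ → B), IsSubstPt σ x y → IsSubstPt σ x' y → x = x'

/-- Cutting points for one-sided sequences. -/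
def cutN (σ : A → List B) (x : ℕ → A) (ℓ : ℕ) : ℕ :=
  ∑ i ∈ Finset.range ℓ, (σ (x i)).length

/-- `y` is the one-sided image `σ(x)` for `x : ℕ → A`. -/
def IsSubstPtN (σ : A → List B) (x : ℕ → A) (y : ℕ → B) : Prop :=
  ∀ (ℓ j : ℕ) (hj : j < (σ (x ℓ)).length),
    y (cutN σ x ℓ + j) = (σ (x ℓ)).get ⟨j, hj⟩

/-- `σ` is injective on one-sided (right-infinite) sequences. -/
def InjN (σ : A → List B) : Prop :=
  ∀ (x x' : ℕ → A) (y : ℕ → B), IsSubstPtN σ x y → IsSubstPtN σ x' y → x = x'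

/-- The total length `⦀σ⦀ = Σ_a |σ a|`. -/
def totalLen (σ : A → List B) [Fintype A] : ℕ := ∑ a, (σ a).length

/-- `X` is invariant under the two-sided shift. -/
def ShiftInvariant (X : Set (ℤ → A)) : Prop :=
  ∀ x ∈ X, (fun n => x (n + 1)) ∈ X ∧ (fun n => x (n - 1)) ∈ X

/-- The iterate `σ^n` of a substitution, applied to a letter. -/
def iter (σ : A → List A) : ℕ → A → List A
  | 0, a => [a]
  | n + 1, a => wordApply (iter σ n) (σ a)

/-- The language `ℒ_σ` of a substitution: subwords of the `σ^n(a)`. -/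
def subLang (σ : A → List A) : Set (List A) := {w | ∃ (n : ℕ) (a : A), w <:+: iter σ n a}

/-- The substitutive shift `X_σ`. -/
def subX (σ : A → List A) : Set (ℤ → A) := {x | ∀ w ∈ lang x, w ∈ subLang σ}

/-- `σ` is recognizable in the sense of Mossé for `x`. -/
def MosseRec (σ : A → List B) (x : ℤ → A) : Prop :=
  ∃ ℓ : ℕ, ∀ y : ℤ → B, IsSubstPt σ x y →
    ∀ m ∈ cutSet σ x 0, ∀ m' : ℤ,
      factor y (m - ℓ) (2 * ℓ) = factor y (m' - ℓ) (2 * ℓ) → m' ∈ cutSet σ x 0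

section Sadic

variable {𝒜 : ℕ → Type*}

/-- `block σ N = σ_[0,N)`, mapping a letter of `𝒜 N` to a word over `𝒜 0`. -/
def block (σ : ∀ n, 𝒜 (n + 1) → List (𝒜 n)) : ∀ N, 𝒜 N → List (𝒜 0)
  | 0, a => [a]
  | N + 1, a => wordApply (block σ N) (σ N a)

/-- `blockFrom σ n k = σ_[n,n+k)`, mapping a letter of `𝒜 (n+k)` to a word over `𝒜 n`. -/
def blockFrom (σ : ∀ n, 𝒜 (n + 1) → List (𝒜 n)) (n k : ℕ) : 𝒜 (n + k) → List (𝒜 n) :=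
  block (𝒜 := fun m => 𝒜 (n + m)) (fun m => σ (n + m)) k

/-- The language `ℒ^(n)_σ` of a directive sequence. -/
def sadicLang (σ : ∀ n, 𝒜 (n + 1) → List (𝒜 n)) (n : ℕ) : Set (List (𝒜 n)) :=
  {w | ∃ (k : ℕ) (a : 𝒜 (n + k)), 1 ≤ k ∧ w <:+: blockFrom σ n k a}

/-- The shift `X^(n)_σ` of a directive sequence. -/
def sadicX (σ : ∀ n, 𝒜 (n + 1) → List (𝒜 n)) (n : ℕ) : Set (ℤ → 𝒜 n) :=
  {x | ∀ w ∈ lang x, w ∈ sadicLang σ n}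

/-- A directive sequence is everywhere growing if `min_a |σ_[0,n)(a)| → ∞`. -/
def EverywhereGrowing (σ : ∀ n, 𝒜 (n + 1) → List (𝒜 n)) : Prop :=
  ∀ m : ℕ, ∃ N : ℕ, ∀ n ≥ N, ∀ a : 𝒜 n, m ≤ (block σ n a).length

end Sadic

end Recog

namespace RecogAux
open Recog

/-- Generalized representation with explicit cutting points. -/
structure R {A B : Type*} (σ : A → List B) (y : ℤ → B) (c : ℤ → ℤ) (x : ℤ → A) : Prop where
  step : ∀ i, c (i + 1) = c i + ((σ (x i)).length : ℤ)
  val : ∀ i (j : ℕ), j < (σ (x i)).length → (σ (x i))[j]? = some (y (c i + j))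

theorem cut_succ {A B : Type*} (σ : A → List B) (x : ℤ → A) (l : ℤ) :
    cut σ x (l + 1) = cut σ x l + ((σ (x l)).length : ℤ) := by
  unfold cut
  rcases lt_trichotomy l (-1) with h | h | h
  · rw [if_neg (by omega), if_neg (by omega)]
    obtain ⟨m, hm⟩ : ∃ m : ℕ, l = -(m : ℤ) - 1 := ⟨(-l - 1).toNat, by omega⟩
    have h1 : (-l).toNat = m + 1 := by omega
    have h2 : (-(l + 1)).toNat = m := by omega
    rw [h1, h2, Finset.sum_range_succ, ← hm]
    ring
  · subst h
    simp
  · rw [if_pos (by omega), if_pos (by omega)]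
    obtain ⟨m, hm⟩ : ∃ m : ℕ, l = (m : ℤ) := ⟨l.toNat, by omega⟩
    have h1 : (l + 1).toNat = m + 1 := by omega
    have h2 : l.toNat = m := by omega
    rw [h1, h2, Finset.sum_range_succ, ← hm]

theorem R_of_rep {A B : Type*} {σ : A → List B} {y : ℤ → B} {k : ℤ} {x : ℤ → A}
    (h : IsRep σ y k x) : R σ y (fun i => cut σ x i - k) x where
  step i := by simp only [cut_succ]; ring
  val i j hj := by
    have := h i j hj
    simp only [List.get_eq_getElem] at this
    rw [List.getElem?_eq_getElem hj, ← this]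
    congr 2
    ring

theorem cut_zero {A B : Type*} (σ : A → List B) (x : ℤ → A) : cut σ x 0 = 0 := by
  simp [cut]

section
variable {A B : Type*} {σ : A → List B} {y : ℤ → B} {c c' : ℤ → ℤ} {x x' : ℤ → A}

theorem R.lt (hσ : NonErasing σ) (h : R σ y c x) (i : ℤ) : c i < c (i + 1) := by
  have := h.step i
  have h2 : 0 < (σ (x i)).length := List.length_pos_iff.2 (hσ _)
  omega

theorem R.mono (hσ : NonErasing σ) (h : R σ y c x) : StrictMono c :=
  strictMono_int_of_lt_succ (h.lt hσ)

theorem R.cover (hσ : NonErasing σ) (h : R σ y c x) (n : ℤ) :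
    ∃ i, ∃ j : ℕ, j < (σ (x i)).length ∧ n = c i + j := by
  have hge : ∀ m : ℕ, c 0 + m ≤ c m := by
    intro m
    induction m with
    | zero => simp
    | succ m ih => have := h.lt hσ m; push_cast; omega
  have hle : ∀ m : ℕ, c (-(m : ℤ)) ≤ c 0 - m := by
    intro m
    induction m with
    | zero => simp
    | succ m ih =>
      have := h.lt hσ (-((m + 1 : ℕ) : ℤ))
      have e : -((m + 1 : ℕ) : ℤ) + 1 = -(m : ℤ) := by push_cast; ring
      rw [e] at this
      push_cast at *
      omega
  obtain ⟨i, hi, hmax⟩ := Int.exists_greatest_of_bdd (P := fun i => c i ≤ n)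
    ⟨((n - c 0).toNat + 1 : ℕ), by
      intro z hz
      by_contra hlt
      push Not at hlt
      have h1 := (h.mono hσ) hlt
      have h2 := hge ((n - c 0).toNat + 1)
      push_cast at *
      omega⟩
    ⟨-((c 0 - n).toNat : ℤ), by have := hle ((c 0 - n).toNat); omega⟩
  have h3 : n < c (i + 1) := by
    by_contra h4
    push Not at h4
    have := hmax (i + 1) h4
    omega
  have := h.step i
  exact ⟨i, (n - c i).toNat, by omega, by omega⟩

theorem R.uniq (hσ : NonErasing σ) (h : R σ y c x) {i i' : ℤ} {j j' : ℕ}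
    (hj : j < (σ (x i)).length) (hj' : j' < (σ (x i')).length) (he : c i + j = c i' + j') :
    i = i' ∧ j = j' := by
  have hm := (h.mono hσ).monotone
  have h1 := h.step i
  have h2 := h.step i'
  rcases lt_trichotomy i i' with hl | hl | hl
  · have := hm (show i + 1 ≤ i' by omega); omega
  · subst hl; exact ⟨rfl, by omega⟩
  · have := hm (show i' + 1 ≤ i by omega); omega

open Classical in
/-- source vertex of an edge -/
noncomputable def src {A : Type*} (e : A × ℕ) : Option (A × ℕ) := if e.2 = 0 then none else some e

open Classical in
/-- target vertex of an edge -/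
noncomputable def tgt {A B : Type*} (σ : A → List B) (e : A × ℕ) : Option (A × ℕ) :=
  if e.2 + 1 = (σ e.1).length then none else some (e.1, e.2 + 1)

theorem R.path (hσ : NonErasing σ) (h : R σ y c x) :
    ∃ e : ℤ → A × ℕ, (∀ i (j : ℕ), j < (σ (x i)).length → e (c i + j) = (x i, j)) ∧
      (∀ n, (e n).2 < (σ (e n).1).length) ∧
      (∀ n, (σ (e n).1)[(e n).2]? = some (y n)) ∧
      (∀ n, tgt σ (e n) = src (e (n + 1))) := by
  choose I J hJ hn using h.cover hσ
  have key : ∀ i (j : ℕ), j < (σ (x i)).length → (x (I (c i + j)), J (c i + j)) = (x i, j) := by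
    intro i j hj
    have := h.uniq hσ (hJ (c i + j)) hj (hn (c i + j)).symm
    rw [this.1, this.2]
  refine ⟨fun n => (x (I n), J n), key, hJ, ?_, ?_⟩
  · intro n
    have := h.val (I n) (J n) (hJ n)
    rw [← hn n] at this
    exact this
  · intro n
    have hs := h.step (I n)
    have hnn := hn n
    by_cases hc : J n + 1 = (σ (x (I n))).length
    · have h1 := key (I n + 1) 0 (List.length_pos_iff.2 (hσ _))
      have h2 : c (I n + 1) + ((0 : ℕ) : ℤ) = n + 1 := by push_cast; omega
      rw [h2] at h1
      have h3 : J (n + 1) = 0 := (Prod.ext_iff.1 h1).2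
      simp only [tgt, src, h3, hc, if_true]
    · have h1 := key (I n) (J n + 1) (by have := hJ n; omega)
      have h2 : c (I n) + ((J n + 1 : ℕ) : ℤ) = n + 1 := by push_cast; omega
      rw [h2] at h1
      have h3 : J (n + 1) = J n + 1 := (Prod.ext_iff.1 h1).2
      simp only [tgt, src, h1, hc, if_false]
      simp [h3]

/-- Two representations with the same edge path are shifts of one another. -/
theorem R.eq_of_path (hσ : NonErasing σ) (h : R σ y c x) (h' : R σ y c' x') {e : ℤ → A × ℕ}
    (he : ∀ i (j : ℕ), j < (σ (x i)).length → e (c i + j) = (x i, j))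
    (he' : ∀ i (j : ℕ), j < (σ (x' i)).length → e (c' i + j) = (x' i, j)) :
    ∃ m, ∀ i, c i = c' (i + m) ∧ x i = x' (i + m) := by
  have hx : ∀ i i', c i = c' i' → x i = x' i' := by
    intro i i' hc
    have h1 := he i 0 (List.length_pos_iff.2 (hσ _))
    have h2 := he' i' 0 (List.length_pos_iff.2 (hσ _))
    rw [hc, h2] at h1
    exact (Prod.ext_iff.1 h1).1.symm
  have hex : ∀ i, ∃ i', c i = c' i' := by
    intro i
    obtain ⟨i', j, hj, hn⟩ := h'.cover hσ (c i)
    have h1 := he i 0 (List.length_pos_iff.2 (hσ _))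
    have h2 := he' i' j hj
    rw [← hn] at h2
    simp only [Nat.cast_zero, add_zero] at h1
    rw [h1] at h2
    have : 0 = j := (Prod.ext_iff.1 h2).2
    subst this
    exact ⟨i', by simpa using hn⟩
  have hup : ∀ i i', c i = c' i' → c (i + 1) = c' (i' + 1) := by
    intro i i' hc
    rw [h.step, h'.step, hc, hx i i' hc]
  obtain ⟨m, hm⟩ := hex 0
  refine ⟨m, ?_⟩
  have key : ∀ i, c i = c' (i + m) := by
    intro i
    induction i with
    | zero => simpa using hm
    | succ i ih => rw [hup _ _ ih]; congr 1; ring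
    | pred i ih =>
      obtain ⟨i', hi'⟩ := hex (-(i : ℤ) - 1)
      have := hup _ _ hi'
      rw [sub_add_cancel, ih] at this
      have := (h'.mono hσ).injective this
      rw [hi']; congr 1; omega
  exact fun i => ⟨key i, hx _ _ (key i)⟩

theorem R.final (hσ : NonErasing σ) (h' : R σ y c' x')
    (hc0 : c 0 ≤ 0) (hc1 : 0 < c 1) (hc0' : c' 0 ≤ 0) (hc1' : 0 < c' 1)
    (hm : ∃ m, ∀ i, c i = c' (i + m) ∧ x i = x' (i + m)) : c = c' ∧ x = x' := by
  obtain ⟨m, hm⟩ := hm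
  have h0 := (hm 0).1
  have h1 := (hm 1).1
  rw [zero_add] at h0
  have a : m < 1 := (h'.mono hσ).lt_iff_lt.1 (by omega)
  have b : 0 < 1 + m := (h'.mono hσ).lt_iff_lt.1 (by omega)
  have : m = 0 := by omega
  subst this
  exact ⟨funext fun i => by simpa using (hm i).1, funext fun i => by simpa using (hm i).2⟩

end

/-- Deterministic pairs of paths. -/
theorem det_path {E V B : Type*} (s t : E → V) (e f : ℤ → E) (y : ℤ → B)
    (he : ∀ n, t (e n) = s (e (n + 1))) (hf : ∀ n, t (f n) = s (f (n + 1)))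
    (hy : ∀ n m, e n = e m → y n = y m)
    (hfin : (Set.range fun n => (e n, f n)).Finite)
    (H1 : ∀ n, s (e n) = s (f n) → e n = f n)
    (H2 : ∀ n m, s (e n) = s (e m) → s (f n) = s (f m) → s (e n) ≠ s (f n) →
      e n = e m ∧ f n = f m)
    (hap : ∀ d : ℕ, 1 ≤ d → ¬ ∀ n : ℤ, y (n + d) = y n) : e = f := by
  by_contra hne
  obtain ⟨m, hm⟩ := Function.ne_iff.1 hne
  have down : ∀ k : ℕ, e (m - k) ≠ f (m - k) := by
    intro k
    induction k with
    | zero => simpa using hm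
    | succ k ih =>
      intro h
      apply ih
      have h1 := he (m - (k + 1 : ℕ))
      have h2 := hf (m - (k + 1 : ℕ))
      have e3 : m - ((k + 1 : ℕ) : ℤ) + 1 = m - k := by push_cast; ring
      rw [e3] at h1 h2
      rw [h] at h1
      exact H1 _ (h1.symm.trans h2)
  have stepeq : ∀ n n', e n = e n' → f n = f n' → e (n + 1) ≠ f (n + 1) →
      e (n + 1) = e (n' + 1) ∧ f (n + 1) = f (n' + 1) := by
    intro n n' h1 h2 h3
    apply H2
    · rw [← he, ← he, h1]
    · rw [← hf, ← hf, h2]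
    · exact fun h => h3 (H1 _ h)
  have : Finite (Set.range fun n => (e n, f n)) := hfin
  obtain ⟨S, hS⟩ := Finite.exists_infinite_fiber
    (fun k : ℕ => (⟨(e (m - k), f (m - k)), ⟨m - k, rfl⟩⟩ : Set.range fun n => (e n, f n)))
  have hS' := Set.infinite_coe_iff.1 hS
  have vis : ∀ K : ℕ, ∃ k > K, e (m - k) = S.1.1 ∧ f (m - k) = S.1.2 := by
    intro K
    obtain ⟨k, hk, hkK⟩ := hS'.exists_gt K
    refine ⟨k, hkK, ?_⟩
    have : (e (m - k), f (m - k)) = S.1 := congrArg Subtype.val hk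
    rw [← this]
    exact ⟨rfl, rfl⟩
  obtain ⟨k2, -, e2, f2⟩ := vis 0
  obtain ⟨k1, hk1, e1, f1⟩ := vis k2
  obtain ⟨d, hd⟩ : ∃ d : ℕ, k1 = k2 + d := ⟨k1 - k2, by omega⟩
  have hd1 : 1 ≤ d := by omega
  have key : ∀ j : ℕ, e (m - k1 + j) ≠ f (m - k1 + j) ∧
      e (m - k1 + j) = e (m - k1 + j + d) ∧ f (m - k1 + j) = f (m - k1 + j + d) := by
    intro j
    induction j using Nat.strong_induction_on with
    | _ j ih =>
      have off : e (m - k1 + j) ≠ f (m - k1 + j) := by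
        by_cases hj : j ≤ k1
        · have := down (k1 - j)
          have e3 : m - ((k1 - j : ℕ) : ℤ) = m - k1 + j := by omega
          rwa [e3] at this
        · have h3 := ih (j - d) (by omega)
          have e3 : m - k1 + ((j - d : ℕ) : ℤ) + d = m - k1 + j := by omega
          rw [e3] at h3
          rw [← h3.2.1, ← h3.2.2]
          exact h3.1
      refine ⟨off, ?_⟩
      cases j with
      | zero =>
        have e3 : m - k1 + ((0 : ℕ) : ℤ) + d = m - k2 := by push_cast; omega
        rw [e3]
        simp only [Nat.cast_zero, add_zero]
        rw [e1, f1, e2, f2]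
        exact ⟨rfl, rfl⟩
      | succ j =>
        have h3 := ih j (by omega)
        have := stepeq _ _ h3.2.1 h3.2.2 (by
          convert off using 2 <;> (push_cast; ring))
        have e3 : m - k1 + (j : ℤ) + 1 = m - k1 + ((j + 1 : ℕ) : ℤ) := by push_cast; ring
        have e4 : m - k1 + (j : ℤ) + d + 1 = m - k1 + ((j + 1 : ℕ) : ℤ) + d := by push_cast; ring
        rwa [e3, e4] at this
  apply hap d hd1
  intro n
  obtain ⟨k0, hk0, e0, f0⟩ := vis (m - n).natAbs
  have same : ∀ j : ℕ, e (m - k1 + j) = e (m - k0 + j) ∧ f (m - k1 + j) = f (m - k0 + j) := by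
    intro j
    induction j with
    | zero =>
      simp only [Nat.cast_zero, add_zero]
      rw [e1, f1, e0, f0]
      exact ⟨rfl, rfl⟩
    | succ j ih =>
      have := stepeq _ _ ih.1 ih.2 (by
        convert (key (j + 1)).1 using 2 <;> (push_cast; ring))
      push_cast
      rw [← add_assoc, ← add_assoc]
      exact this
  obtain ⟨j, hj⟩ : ∃ j : ℕ, n = m - k0 + j := ⟨(n - m + k0).toNat, by omega⟩
  apply hy
  have h1 := (same j).1
  have h2 := (same (j + d)).1
  have h3 := (key j).2.1
  push_cast at h2
  rw [← add_assoc, ← add_assoc] at h2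
  rw [hj, ← h1, h3, h2]

/-- Left permutative case. -/
theorem path_left {A B : Type*} [Finite A] {σ : A → List B} {y : ℤ → B}
    (hL : LeftPermutative σ) {e f : ℤ → A × ℕ}
    (he1 : ∀ n, (σ (e n).1)[(e n).2]? = some (y n)) (hf1 : ∀ n, (σ (f n).1)[(f n).2]? = some (y n))
    (he : ∀ n, tgt σ (e n) = src (e (n + 1))) (hf : ∀ n, tgt σ (f n) = src (f (n + 1)))
    (hfin : (Set.range fun n => (e n, f n)).Finite)
    (hap : ∀ d : ℕ, 1 ≤ d → ¬ ∀ n : ℤ, y (n + d) = y n) : e = f := by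
  have key : ∀ (u v : A × ℕ) (b : B), (σ u.1)[u.2]? = some b → (σ v.1)[v.2]? = some b →
      src u = src v → u = v := by
    rintro ⟨a, i⟩ ⟨a', j⟩ b h1 h2 h3
    simp only [src] at *
    split_ifs at h3 with h4 h5 h5
    · subst h4 h5
      by_contra hne
      apply hL a a' (fun h => hne (by rw [h]))
      rw [List.head?_eq_getElem?, List.head?_eq_getElem?, h1, h2]
    · exact Option.some.inj h3
  have key2 : ∀ u v : A × ℕ, src u = src v → src u ≠ none → u = v := by
    intro u v h1 h2
    simp only [src] at *
    split_ifs at h1 h2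
    · exact absurd rfl h2
    · exact Option.some.inj h1
  have hy : ∀ n m, e n = e m → y n = y m := by
    intro n m h
    have := he1 n
    rw [h, he1 m] at this
    exact (Option.some.inj this).symm
  have hy' : ∀ n m, f n = f m → y n = y m := by
    intro n m h
    have := hf1 n
    rw [h, hf1 m] at this
    exact (Option.some.inj this).symm
  refine det_path src (tgt σ) e f y he hf hy hfin ?_ ?_ hap
  · exact fun n h => key _ _ _ (he1 n) (hf1 n) h
  · intro n m h1 h2 h3
    by_cases h4 : src (e n) = none
    · have h5 : src (f n) ≠ none := fun h => h3 (h4.trans h.symm)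
      have h6 := key2 _ _ h2 h5
      refine ⟨key _ _ (y n) (he1 n) ?_ h1, h6⟩
      rw [he1 m, hy' _ _ h6]
    · have h6 := key2 _ _ h1 h4
      refine ⟨h6, key _ _ (y n) (hf1 n) ?_ h2⟩
      rw [hf1 m, hy _ _ h6]

/-- Right permutative case. -/
theorem path_right {A B : Type*} [Finite A] {σ : A → List B} {y : ℤ → B}
    (hL : RightPermutative σ) {e f : ℤ → A × ℕ}
    (he1 : ∀ n, (σ (e n).1)[(e n).2]? = some (y n)) (hf1 : ∀ n, (σ (f n).1)[(f n).2]? = some (y n))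
    (he : ∀ n, tgt σ (e n) = src (e (n + 1))) (hf : ∀ n, tgt σ (f n) = src (f (n + 1)))
    (hfin : (Set.range fun n => (e n, f n)).Finite)
    (hap : ∀ d : ℕ, 1 ≤ d → ¬ ∀ n : ℤ, y (n + d) = y n) : e = f := by
  have key : ∀ (u v : A × ℕ) (b : B), (σ u.1)[u.2]? = some b → (σ v.1)[v.2]? = some b →
      tgt σ u = tgt σ v → u = v := by
    rintro ⟨a, i⟩ ⟨a', j⟩ b h1 h2 h3
    simp only [tgt] at *
    split_ifs at h3 with h4 h5 h5
    · have haa : a = a' := by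
        by_contra hne
        apply hL a a' hne
        rw [List.getLast?_eq_getElem?, List.getLast?_eq_getElem?, ← h4, ← h5]
        simp [h1, h2]
      subst haa
      have : i = j := by omega
      rw [this]
    · have := Prod.ext_iff.1 (Option.some.inj h3)
      simp only [Nat.add_right_cancel_iff] at this
      rw [this.1, this.2]
  have key2 : ∀ u v : A × ℕ, tgt σ u = tgt σ v → tgt σ u ≠ none → u = v := by
    rintro ⟨a, i⟩ ⟨a', j⟩ h3 h2
    simp only [tgt] at *
    split_ifs at h3 h2
    · exact absurd rfl h2
    · have := Prod.ext_iff.1 (Option.some.inj h3)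
      simp only [Nat.add_right_cancel_iff] at this
      rw [this.1, this.2]
  have hy : ∀ n m, e n = e m → y n = y m := by
    intro n m h
    have := he1 n
    rw [h, he1 m] at this
    exact (Option.some.inj this).symm
  have hy' : ∀ n m, f n = f m → y n = y m := by
    intro n m h
    have := hf1 n
    rw [h, hf1 m] at this
    exact (Option.some.inj this).symm
  have := det_path (tgt σ) src (fun n => e (-n)) (fun n => f (-n)) (fun n => y (-n)) ?_ ?_
    (fun n m h => hy _ _ h) (hfin.subset ?_) ?_ ?_ ?_
  · funext n
    have := congrFun this (-n)
    simpa using this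
  · intro n
    have := he (-(n + 1))
    rw [this]; congr 2; ring
  · intro n
    have := hf (-(n + 1))
    rw [this]; congr 2; ring
  · rintro _ ⟨n, rfl⟩
    exact ⟨-n, rfl⟩
  · exact fun n h => key _ _ _ (he1 (-n)) (hf1 (-n)) h
  · intro n m h1 h2 h3
    by_cases h4 : tgt σ (e (-n)) = none
    · have h5 : tgt σ (f (-n)) ≠ none := fun h => h3 (h4.trans h.symm)
      have h6 := key2 _ _ h2 h5
      refine ⟨key _ _ (y (-n)) (he1 (-n)) ?_ h1, h6⟩
      rw [he1 (-m), hy' _ _ h6]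
    · have h6 := key2 _ _ h1 h4
      refine ⟨h6, key _ _ (y (-n)) (hf1 (-n)) ?_ h2⟩
      rw [hf1 (-m), hy _ _ h6]
  · intro d hd h
    apply hap d hd
    intro n
    have := h (-n - d)
    have e1 : -(-n - (d : ℤ) + d) = n := by ring
    have e2 : -(-n - (d : ℤ)) = n + d := by ring
    simp only [e1, e2] at this
    exact this.symm

/-- Linear-algebra step. -/
theorem path_rank {E V B : Type*} (s t : E → V) (e f : ℤ → E) (y : ℤ → B) (lab : E → B)
    (he : ∀ n, t (e n) = s (e (n + 1))) (hf : ∀ n, t (f n) = s (f (n + 1)))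
    (hey : ∀ n, lab (e n) = y n) (hfy : ∀ n, lab (f n) = y n)
    (hfin : (Set.range fun n => (e n, f n)).Finite)
    (hg : ∀ g : E → ℚ, ∃ (ω : B → ℚ) (h : V → ℚ), ∀ n,
      g (e n) = ω (lab (e n)) + h (t (e n)) - h (s (e n)) ∧
      g (f n) = ω (lab (f n)) + h (t (f n)) - h (s (f n)))
    (hap : ∀ d : ℕ, 1 ≤ d → ¬ ∀ n : ℤ, y (n + d) = y n) : e = f := by
  classical
  let d : ℤ → (E →₀ ℚ) := fun n => Finsupp.single (e n) 1 - Finsupp.single (f n) 1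
  let v : ℤ → (V →₀ ℚ) := fun n => Finsupp.single (s (e n)) 1 - Finsupp.single (s (f n)) 1
  let DE := Submodule.span ℚ (Set.range d)
  let DV := Submodule.span ℚ (Set.range v)
  let S : (E →₀ ℚ) →ₗ[ℚ] (V →₀ ℚ) := Finsupp.lmapDomain ℚ ℚ s
  let T : (E →₀ ℚ) →ₗ[ℚ] (V →₀ ℚ) := Finsupp.lmapDomain ℚ ℚ t
  have hSd : ∀ n, S (d n) = v n := by
    intro n
    simp only [S, d, v, map_sub, Finsupp.lmapDomain_apply, Finsupp.mapDomain_single]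
  have hTd : ∀ n, T (d n) = v (n + 1) := by
    intro n
    simp only [T, d, v, map_sub, Finsupp.lmapDomain_apply, Finsupp.mapDomain_single, he, hf]
  have fE : (Set.range d).Finite := by
    refine (hfin.image (fun p => Finsupp.single p.1 (1 : ℚ) - Finsupp.single p.2 1)).subset ?_
    rintro _ ⟨n, rfl⟩
    exact ⟨_, ⟨n, rfl⟩, rfl⟩
  have fV : (Set.range v).Finite := by
    refine (fE.image S).subset ?_
    rintro _ ⟨n, rfl⟩
    exact ⟨_, ⟨n, rfl⟩, hSd n⟩
  have : FiniteDimensional ℚ DE := FiniteDimensional.span_of_finite ℚ fE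
  have : FiniteDimensional ℚ DV := FiniteDimensional.span_of_finite ℚ fV
  have mS : ∀ z ∈ DE, S z ∈ DV := by
    intro z hz
    have : DE ≤ DV.comap S := by
      refine Submodule.span_le.2 ?_
      rintro _ ⟨n, rfl⟩
      change S (d n) ∈ DV
      rw [hSd]
      exact Submodule.subset_span ⟨n, rfl⟩
    exact this hz
  have mT : ∀ z ∈ DE, (T - S) z ∈ DV := by
    intro z hz
    have : DE ≤ DV.comap (T - S) := by
      refine Submodule.span_le.2 ?_
      rintro _ ⟨n, rfl⟩
      change (T - S) (d n) ∈ DV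
      rw [LinearMap.sub_apply, hSd, hTd]
      exact DV.sub_mem (Submodule.subset_span ⟨_, rfl⟩) (Submodule.subset_span ⟨_, rfl⟩)
    exact this hz
  let S' : DE →ₗ[ℚ] DV := S.restrict mS
  let D' : DE →ₗ[ℚ] DV := (T - S).restrict mT
  have injD : Function.Injective D' := by
    rw [← LinearMap.ker_eq_bot, LinearMap.ker_eq_bot']
    rintro ⟨z, hz⟩ h0
    have h0' : (T - S) z = 0 := congrArg Subtype.val h0
    have pair : ∀ g : E → ℚ, Finsupp.linearCombination ℚ g z = 0 := by
      intro g
      obtain ⟨ω, h, hgh⟩ := hg g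
      have : DE ≤ LinearMap.eqLocus (Finsupp.linearCombination ℚ g)
          ((Finsupp.linearCombination ℚ h).comp (T - S)) := by
        refine Submodule.span_le.2 ?_
        rintro _ ⟨n, rfl⟩
        change Finsupp.linearCombination ℚ g (d n) = Finsupp.linearCombination ℚ h ((T - S) (d n))
        rw [LinearMap.sub_apply, hSd, hTd]
        simp only [d, v, map_sub, Finsupp.linearCombination_single, one_smul]
        rw [(hgh n).1, (hgh n).2, hey, hfy, he, hf]
        ring
      have h1 : Finsupp.linearCombination ℚ g z = Finsupp.linearCombination ℚ h ((T - S) z) :=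
        this hz
      rw [h1, h0', map_zero]
    apply Subtype.ext
    change z = 0
    ext a
    have := pair (Pi.single a 1)
    rw [Finsupp.linearCombination_apply, Finsupp.sum] at this
    simp only [smul_eq_mul, Pi.single_apply, mul_ite, mul_one, mul_zero,
      Finset.sum_ite_eq', Finsupp.mem_support_iff] at this
    simpa using this
  have surS : Function.Surjective S' := by
    rintro ⟨z, hz⟩
    have : DV ≤ DE.map S := by
      refine Submodule.span_le.2 ?_
      rintro _ ⟨n, rfl⟩
      exact ⟨d n, Submodule.subset_span ⟨n, rfl⟩, hSd n⟩
    obtain ⟨w, hw, hwz⟩ := this hz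
    exact ⟨⟨w, hw⟩, Subtype.ext hwz⟩
  have hrank : Module.finrank ℚ DE = Module.finrank ℚ DV :=
    le_antisymm (LinearMap.finrank_le_finrank_of_injective injD)
      (LinearMap.finrank_le_finrank_of_surjective surS)
  have injS : Function.Injective S' :=
    (LinearMap.injective_iff_surjective_of_finrank_eq_finrank hrank).2 surS
  have injd : ∀ z ∈ DE, ∀ w ∈ DE, S z = S w → z = w := by
    intro z hz w hw h
    have := @injS ⟨z, hz⟩ ⟨w, hw⟩ (Subtype.ext h)
    exact congrArg Subtype.val this
  have dm : ∀ n, d n ∈ DE := fun n => Submodule.subset_span ⟨n, rfl⟩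
  have hy : ∀ n m, e n = e m → y n = y m := by
    intro n m h
    rw [← hey, ← hey, h]
  refine det_path s t e f y he hf hy hfin ?_ ?_ hap
  · intro n h
    have h1 : d n = 0 := by
      refine injd _ (dm n) _ DE.zero_mem ?_
      rw [hSd, map_zero]
      simp only [v, h, sub_self]
    have h2 := sub_eq_zero.1 h1
    exact Finsupp.single_left_injective one_ne_zero h2
  · intro n m h1 h2 h3
    have hne : e n ≠ f n := fun h => h3 (by rw [h])
    have h4 : d n = d m := by
      refine injd _ (dm n) _ (dm m) ?_
      rw [hSd, hSd]
      simp only [v, h1, h2]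
    constructor
    · by_contra h5
      have := DFunLike.congr_fun h4 (e n)
      simp only [d, Finsupp.sub_apply, Finsupp.single_apply, if_true, if_neg hne.symm,
        if_neg (Ne.symm h5)] at this
      split_ifs at this <;> norm_num at this
    · by_contra h5
      have := DFunLike.congr_fun h4 (f n)
      simp only [d, Finsupp.sub_apply, Finsupp.single_apply, if_true, if_neg hne,
        if_neg (Ne.symm h5)] at this
      split_ifs at this <;> norm_num at this

theorem sum_getElem {B : Type*} (w : Option B → ℚ) (l : List B) :
    ∑ j ∈ Finset.range l.length, w l[j]? = (l.map fun b => w (some b)).sum := by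
  induction l with
  | nil => simp
  | cons a l ih =>
    rw [List.length_cons, Finset.sum_range_succ']
    simp [ih, add_comm]

theorem sum_count {B : Type*} [Fintype B] [DecidableEq B] (w : B → ℚ) (l : List B) :
    ∑ b, (l.count b : ℚ) * w b = (l.map w).sum := by
  induction l with
  | nil => simp
  | cons a l ih =>
    simp only [List.count_cons, List.map_cons, List.sum_cons, ← ih]
    push_cast
    simp only [add_mul, Finset.sum_add_distrib]
    rw [add_comm]
    congr 1
    simp

theorem weights {A B : Type*} [Fintype A] [Fintype B] [DecidableEq B] {σ : A → List B}
    (h : (incidence σ).rank = Fintype.card A) (G : A → ℚ) :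
    ∃ w : B → ℚ, ∀ a, ((σ a).map w).sum = G a := by
  have h1 : (incidence σ).transpose.rank = Fintype.card A := by rw [Matrix.rank_transpose, h]
  have h2 : LinearMap.range (incidence σ).transpose.mulVecLin = ⊤ := by
    apply Submodule.eq_top_of_finrank_eq
    rw [Module.finrank_fintype_fun_eq_card]
    exact h1
  obtain ⟨w, hw⟩ := LinearMap.range_eq_top.1 h2 G
  refine ⟨w, fun a => ?_⟩
  rw [← hw, ← sum_count]
  rfl

theorem cochain {A B : Type*} [Fintype A] [Fintype B] [DecidableEq B] {σ : A → List B}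
    (hr : (incidence σ).rank = Fintype.card A) (g : A × ℕ → ℚ) :
    ∃ (w : Option B → ℚ) (h : Option (A × ℕ) → ℚ), ∀ e : A × ℕ, e.2 < (σ e.1).length →
      g e = w ((σ e.1)[e.2]?) + h (tgt σ e) - h (src e) := by
  obtain ⟨w, hw⟩ := weights hr (fun a => ∑ j ∈ Finset.range (σ a).length, g (a, j))
  let w' : Option B → ℚ := fun o => o.elim 0 w
  let H : A × ℕ → ℚ := fun p => ∑ i ∈ Finset.range p.2, (g (p.1, i) - w' ((σ p.1)[i]?))
  refine ⟨w', fun o => o.elim 0 H, ?_⟩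
  rintro ⟨a, j⟩ hj
  have h0 : H (a, (σ a).length) = 0 := by
    simp only [H, Finset.sum_sub_distrib]
    rw [sum_getElem, ← hw]
    simp [w']
  have hs : (src (a, j)).elim 0 H = H (a, j) := by
    simp only [src]
    split_ifs with h
    · subst h; simp [H]
    · simp
  have ht : (tgt σ (a, j)).elim 0 H = H (a, j + 1) := by
    simp only [tgt]
    split_ifs with h
    · rw [h, h0]; simp
    · simp
  simp only [hs, ht]
  simp only [H, Finset.sum_range_succ]
  ring

section
variable {A B : Type*} {σ σ' : A → List B} {y : ℤ → B} {c c' : ℤ → ℤ} {x x' : ℤ → A}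

theorem R.conj1 {w : List B} (hw : ∀ a, σ a ++ w = w ++ σ' a) (hσ : NonErasing σ)
    (h : R σ y c x) : R σ' y (fun i => c i + w.length) x := by
  have hl : ∀ a, (σ a).length = (σ' a).length := by
    intro a
    have := congrArg List.length (hw a)
    simp only [List.length_append] at this
    omega
  have W : ∀ j < w.length, ∀ i, w[j]? = some (y (c i + j)) := by
    intro j
    induction j using Nat.strong_induction_on with
    | _ j ih =>
      intro hj i
      have h1 : (σ (x i) ++ w)[j]? = w[j]? := by
        rw [hw, List.getElem?_append_left hj]
      rw [← h1]
      have hpos : 0 < (σ (x i)).length := List.length_pos_iff.2 (hσ _)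
      by_cases hc : j < (σ (x i)).length
      · rw [List.getElem?_append_left hc, h.val i j hc]
      · rw [List.getElem?_append_right (by omega), ih (j - (σ (x i)).length) (by omega) (by omega)
          (i + 1), h.step]
        congr 2
        omega
  refine ⟨fun i => ?_, fun i j hj => ?_⟩
  · rw [h.step, hl]; ring
  · have h1 : (w ++ σ' (x i))[w.length + j]? = (σ' (x i))[j]? := by
      rw [List.getElem?_append_right (by omega)]
      congr 1; omega
    rw [← h1, ← hw]
    by_cases hc : w.length + j < (σ (x i)).length
    · rw [List.getElem?_append_left hc, h.val i _ hc]
      congr 2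
      push_cast; ring
    · have := hl (x i)
      rw [List.getElem?_append_right (by omega), W _ (by omega) (i + 1), h.step]
      congr 2
      omega

theorem R.conj2 {w : List B} (hw : ∀ a, w ++ σ a = σ' a ++ w) (hσ : NonErasing σ)
    (h : R σ y c x) : R σ' y (fun i => c i - w.length) x := by
  have hl : ∀ a, (σ a).length = (σ' a).length := by
    intro a
    have := congrArg List.length (hw a)
    simp only [List.length_append] at this
    omega
  have W : ∀ j, 0 < j → j ≤ w.length → ∀ i, w[w.length - j]? = some (y (c i - j)) := by
    intro j
    induction j using Nat.strong_induction_on with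
    | _ j ih =>
      intro hj0 hj i
      have hl1 := hl (x (i - 1))
      have hs := h.step (i - 1)
      rw [sub_add_cancel] at hs
      have h1 : (σ' (x (i - 1)) ++ w)[(σ (x (i - 1))).length + (w.length - j)]?
          = w[w.length - j]? := by
        rw [List.getElem?_append_right (by omega)]
        congr 1; omega
      rw [← h1, ← hw]
      have hpos : 0 < (σ (x (i - 1))).length := List.length_pos_iff.2 (hσ _)
      by_cases hc : j ≤ (σ (x (i - 1))).length
      · rw [List.getElem?_append_right (by omega), h.val (i - 1) _ (by omega)]
        congr 2
        omega
      · rw [List.getElem?_append_left (by omega)]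
        have := ih (j - (σ (x (i - 1))).length) (by omega) (by omega) (by omega) (i - 1)
        have e1 : w.length - (j - (σ (x (i - 1))).length)
          = (σ (x (i - 1))).length + (w.length - j) := by omega
        rw [e1] at this
        rw [this]
        congr 2
        omega
  refine ⟨fun i => ?_, fun i j hj => ?_⟩
  · rw [h.step, hl]; ring
  · have h1 : (σ' (x i) ++ w)[j]? = (σ' (x i))[j]? := by
      rw [List.getElem?_append_left hj]
    rw [← h1, ← hw]
    by_cases hc : j < w.length
    · rw [List.getElem?_append_left hc]
      have := W (w.length - j) (by omega) (by omega) i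
      have e1 : w.length - (w.length - j) = j := by omega
      rw [e1] at this
      rw [this]
      congr 2
      omega
    · have := hl (x i)
      rw [List.getElem?_append_right (by omega), h.val i _ (by omega)]
      congr 2
      omega

theorem R.main [Finite A] (hσ : NonErasing σ) (h : R σ y c x) (h' : R σ y c' x')
    (hP : ∀ e f : ℤ → A × ℕ,
      (∀ n, (e n).2 < (σ (e n).1).length) → (∀ n, (f n).2 < (σ (f n).1).length) →
      (∀ n, (σ (e n).1)[(e n).2]? = some (y n)) → (∀ n, (σ (f n).1)[(f n).2]? = some (y n)) →
      (∀ n, tgt σ (e n) = src (e (n + 1))) → (∀ n, tgt σ (f n) = src (f (n + 1))) →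
      (Set.range fun n => (e n, f n)).Finite → e = f) :
    ∃ m, ∀ i, c i = c' (i + m) ∧ x i = x' (i + m) := by
  obtain ⟨e, e1, e2, e3, e4⟩ := h.path hσ
  obtain ⟨f, f1, f2, f3, f4⟩ := h'.path hσ
  have hfinE : {p : A × ℕ | p.2 < (σ p.1).length}.Finite := by
    obtain ⟨N, hN⟩ := (Set.finite_range fun a => (σ a).length).bddAbove
    refine ((Set.finite_univ (α := A)).prod (Set.finite_Iio N)).subset ?_
    rintro ⟨a, j⟩ hj
    exact ⟨trivial, lt_of_lt_of_le hj (hN ⟨a, rfl⟩)⟩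
  have hef : e = f := by
    refine hP e f e2 f2 e3 f3 e4 f4 ((hfinE.prod hfinE).subset ?_)
    rintro _ ⟨n, rfl⟩
    exact ⟨e2 n, f2 n⟩
  subst hef
  exact h.eq_of_path hσ h' e1 f1

end

theorem compare {B : Type*} (u v : List B) : (∃ r, u = v ++ r) ∨ (∃ r, v = u ++ r) ∨
    ∃ (z α β : List B) (c d : B), c ≠ d ∧ u = z ++ c :: α ∧ v = z ++ d :: β := by
  induction u generalizing v with
  | nil => exact Or.inr (Or.inl ⟨v, rfl⟩)
  | cons a u ih =>
    cases v with
    | nil => exact Or.inl ⟨_, rfl⟩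
    | cons b v =>
      by_cases hab : a = b
      · subst hab
        rcases ih v with ⟨r, hr⟩ | ⟨r, hr⟩ | ⟨z, α, β, c, d, hcd, h1, h2⟩
        · exact Or.inl ⟨r, by rw [hr]; rfl⟩
        · exact Or.inr (Or.inl ⟨r, by rw [hr]; rfl⟩)
        · exact Or.inr (Or.inr ⟨a :: z, α, β, c, d, hcd, by rw [h1]; rfl, by rw [h2]; rfl⟩)
      · exact Or.inr (Or.inr ⟨[], u, v, a, b, hab, rfl, rfl⟩)

/-- `t`-power -/
def Pw {B : Type*} (t u : List B) : Prop := ∃ k : ℕ, u = (List.replicate k t).flatten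

theorem Pw.append {B : Type*} {t u v : List B} (hu : Pw t u) (hv : Pw t v) : Pw t (u ++ v) := by
  obtain ⟨k, rfl⟩ := hu
  obtain ⟨l, rfl⟩ := hv
  exact ⟨k + l, by rw [List.replicate_add, List.flatten_append]⟩

theorem binary {B : Type*} (N : ℕ) : ∀ u v : List B, u ≠ [] → v ≠ [] → u.length + v.length ≤ N →
    (∃ t, Pw t u ∧ Pw t v) ∨
    ∃ z α β, u ++ z = z ++ α ∧ v ++ z = z ++ β ∧ α.head? ≠ β.head? := by
  induction N with
  | zero =>
    intro u v hu hv h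
    exact absurd (List.length_eq_zero_iff.1 (by omega)) hu
  | succ N ih =>
    intro u v hu hv h
    have hul : 0 < u.length := List.length_pos_iff.2 hu
    have hvl : 0 < v.length := List.length_pos_iff.2 hv
    rcases compare u v with ⟨r, hr⟩ | ⟨r, hr⟩ | ⟨z, α, β, c, d, hcd, h1, h2⟩
    · subst hr
      by_cases h0 : r = []
      · subst h0
        exact Or.inl ⟨v, ⟨1, by simp⟩, ⟨1, by simp⟩⟩
      · rw [List.length_append] at h
        rcases ih r v h0 hv (by omega) with ⟨t, h1, h2⟩ | ⟨z, α, β, h1, h2, h3⟩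
        · exact Or.inl ⟨t, h2.append h1, h2⟩
        · refine Or.inr ⟨v ++ z, α ++ β, β, ?_, ?_, ?_⟩
          · simp only [List.append_assoc]
            rw [h2, ← List.append_assoc r, h1]
            simp
          · simp only [List.append_assoc]
            rw [h2]
          · have : α ≠ [] := by
              rintro rfl
              have g1 := congrArg List.length h1
              have g2 := List.length_pos_iff.2 h0
              simp only [List.length_append, List.length_nil] at g1
              omega
            rwa [List.head?_append_of_ne_nil _ this]
    · subst hr
      by_cases h0 : r = []
      · subst h0
        exact Or.inl ⟨u, ⟨1, by simp⟩, ⟨1, by simp⟩⟩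
      · rw [List.length_append] at h
        rcases ih u r hu h0 (by omega) with ⟨t, h1, h2⟩ | ⟨z, α, β, h1, h2, h3⟩
        · exact Or.inl ⟨t, h1, h1.append h2⟩
        · refine Or.inr ⟨u ++ z, α, β ++ α, ?_, ?_, ?_⟩
          · simp only [List.append_assoc]
            rw [h1]
          · simp only [List.append_assoc]
            rw [h1, ← List.append_assoc r, h2]
            simp
          · have : β ≠ [] := by
              rintro rfl
              have g1 := congrArg List.length h2
              have g2 := List.length_pos_iff.2 h0
              simp only [List.length_append, List.length_nil] at g1
              omega
            rwa [List.head?_append_of_ne_nil _ this]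
    · refine Or.inr ⟨z, c :: α ++ z, d :: β ++ z, by rw [h1]; simp, by rw [h2]; simp, ?_⟩
      simpa using hcd

theorem pw_get {B : Type*} (t : List B) (k j : ℕ) (hj : j < k * t.length) :
    ((List.replicate k t).flatten)[j]? = t[j % t.length]? := by
  induction k generalizing j with
  | zero => simp at hj
  | succ k ih =>
    rw [List.replicate_succ, List.flatten_cons]
    by_cases hc : j < t.length
    · rw [List.getElem?_append_left hc, Nat.mod_eq_of_lt hc]
    · push Not at hc
      rw [List.getElem?_append_right hc, ih _ (by rw [Nat.succ_mul] at hj; omega),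
        Nat.mod_eq_sub_mod hc]

theorem periodic_of_pw {A B : Type*} {σ : A → List B} {y : ℤ → B} {c : ℤ → ℤ} {x : ℤ → A}
    (hσ : NonErasing σ) (h : R σ y c x) (t : List B) (ht : ∀ a, Pw t (σ a)) :
    ∃ d : ℕ, 1 ≤ d ∧ ∀ n : ℤ, y (n + d) = y n := by
  choose K hK using ht
  have hlen : ∀ a, (σ a).length = K a * t.length := by
    intro a; rw [hK a]; simp
  have hpos : ∀ a, 0 < K a * t.length := by
    intro a; rw [← hlen]; exact List.length_pos_iff.2 (hσ a)
  have hv : ∀ i (j : ℕ), j < K (x i) * t.length → some (y (c i + j)) = t[j % t.length]? := by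
    intro i j hj
    rw [← h.val i j (by rw [hlen]; exact hj), ← pw_get t _ j hj, ← hK]
  have htp : 0 < t.length := Nat.pos_of_mul_pos_left (hpos (x 0))
  refine ⟨t.length, htp, fun n => ?_⟩
  obtain ⟨i, j, hj, rfl⟩ := h.cover hσ n
  rw [hlen] at hj
  apply Option.some.inj
  rw [hv i j hj]
  by_cases hc : j + t.length < K (x i) * t.length
  · have := hv i _ hc
    rw [Nat.add_mod_right] at this
    rw [← this]
    congr 2
    push_cast; ring
  · obtain ⟨q, hq⟩ : ∃ q, K (x i) = q + 1 :=
      ⟨K (x i) - 1, by have := Nat.pos_of_mul_pos_right (hpos (x i)); omega⟩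
    have hst := h.step i
    rw [hlen] at hst
    rw [hq, Nat.succ_mul] at hc hj hst
    obtain ⟨r, hr⟩ : ∃ r, j = r + q * t.length := ⟨j - q * t.length, by omega⟩
    have hrt : r < t.length := by omega
    have hle : t.length ≤ K (x (i + 1)) * t.length :=
      Nat.le_mul_of_pos_left _ (Nat.pos_of_mul_pos_right (hpos (x (i + 1))))
    have := hv (i + 1) r (by omega)
    rw [hr, Nat.add_mul_mod_self_right, ← this, hst]
    congr 2
    push_cast; ring

end RecogAux

open Recog in
/-- A morphism with full-rank incidence matrix, or on a two-letter alphabet,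
or rotationally conjugate to a left or right permutative morphism, is fully recognizable
for aperiodic points. -/
theorem stmt0 {A B : Type*} [Fintype A] [Fintype B] [DecidableEq B]
    (σ : A → List B) (hσ : NonErasing σ)
    (hcond : (incidence σ).rank = Fintype.card A ∨ Fintype.card A = 2 ∨
      ∃ σ' : A → List B, NonErasing σ' ∧ RotConj σ σ' ∧
        (LeftPermutative σ' ∨ RightPermutative σ')) :
    RecInAp σ (Set.univ : Set (ℤ → A)) := by
  intro y hy k k' x x' _ _ h h'
  have hap : ∀ d : ℕ, 1 ≤ d → ¬ ∀ n : ℤ, y (n + d) = y n :=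
    fun d hd hn => hy d hd (funext hn)
  have hR := RecogAux.R_of_rep h.1
  have hR' := RecogAux.R_of_rep h'.1
  have conjCase : ∀ σ' : A → List B, NonErasing σ' → RotConj σ σ' →
      (LeftPermutative σ' ∨ RightPermutative σ') →
      ∃ m : ℤ, ∀ i, cut σ x i - k = cut σ x' (i + m) - k' ∧ x i = x' (i + m) := by
    intro σ' hne hconj hperm
    have fin : ∀ c c' : ℤ → ℤ, RecogAux.R σ' y c x → RecogAux.R σ' y c' x' →
        ∃ m, ∀ i, c i = c' (i + m) ∧ x i = x' (i + m) := by
      intro c c' r r'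
      refine r.main hne r' ?_
      intro e f _ _ e1 f1 e2 f2 hf
      rcases hperm with hp | hp
      · exact RecogAux.path_left hp e1 f1 e2 f2 hf hap
      · exact RecogAux.path_right hp e1 f1 e2 f2 hf hap
    obtain ⟨w, hw | hw⟩ := hconj
    · obtain ⟨m, hm⟩ := fin _ _ (hR.conj1 hw hσ) (hR'.conj1 hw hσ)
      exact ⟨m, fun i => ⟨add_right_cancel (hm i).1, (hm i).2⟩⟩
    · obtain ⟨m, hm⟩ := fin _ _ (hR.conj2 hw hσ) (hR'.conj2 hw hσ)
      exact ⟨m, fun i => ⟨sub_left_injective (hm i).1, (hm i).2⟩⟩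
  have main : ∃ m : ℤ, ∀ i, cut σ x i - k = cut σ x' (i + m) - k' ∧ x i = x' (i + m) := by
    rcases hcond with hr | h2 | ⟨σ', hne, hconj, hperm⟩
    · refine hR.main hσ hR' ?_
      intro e f e0 f0 e1 f1 e2 f2 hf
      refine RecogAux.path_rank RecogAux.src (RecogAux.tgt σ) e f (fun n => some (y n))
        (fun p => (σ p.1)[p.2]?) e2 f2 e1 f1 hf ?_ ?_
      · intro g
        obtain ⟨w, hh, H⟩ := RecogAux.cochain hr g
        exact ⟨w, hh, fun n => ⟨H _ (e0 n), H _ (f0 n)⟩⟩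
      · exact fun d hd hn => hap d hd fun n => Option.some.inj (hn n)
    · classical
      obtain ⟨a, b, hab, huniv⟩ := Finset.card_eq_two.1 (Finset.card_univ (α := A) ▸ h2)
      have hall : ∀ z : A, z = a ∨ z = b := by
        intro z
        have := Finset.mem_univ z
        rw [huniv] at this
        simpa using this
      rcases RecogAux.binary _ (σ a) (σ b) (hσ a) (hσ b) le_rfl with
        ⟨t, ha, hb⟩ | ⟨z, α, β, h1, h2, h3⟩
      · obtain ⟨d, hd, hn⟩ := RecogAux.periodic_of_pw hσ hR t (by
          intro q
          rcases hall q with rfl | rfl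
          · exact ha
          · exact hb)
        exact absurd hn (hap d hd)
      · have hc : ∀ q, σ q ++ z = z ++ (if q = a then α else β) := by
          intro q
          rcases hall q with rfl | rfl
          · rw [if_pos rfl, h1]
          · rw [if_neg hab.symm, h2]
        refine conjCase (fun q => if q = a then α else β) ?_ ⟨z, Or.inl hc⟩ (Or.inl ?_)
        · intro q hq
          have h4 := congrArg List.length (hc q)
          have h5 := List.length_pos_iff.2 (hσ q)
          simp only at hq
          rw [hq] at h4
          simp only [List.length_append, List.length_nil] at h4
          omega
        · intro p q hpq
          rcases hall p with rfl | rfl <;> rcases hall q with rfl | rfl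
          · exact absurd rfl hpq
          · simpa [hab.symm] using h3
          · simpa [hab.symm] using h3.symm
          · exact absurd rfl hpq
    · exact conjCase σ' hne hconj hperm
  have step1 := RecogAux.cut_succ σ x 0
  have step2 := RecogAux.cut_succ σ x' 0
  rw [RecogAux.cut_zero, zero_add] at step1 step2
  have z1 := RecogAux.cut_zero σ x
  have z2 := RecogAux.cut_zero σ x'
  have b1 := h.2
  have b2 := h'.2
  have hfin := RecogAux.R.final (c := fun i => cut σ x i - k) (x := x) hσ hR'
    (by simp only [z1]; omega) (by simp only [step1]; omega)
    (by simp only [z2]; omega) (by simp only [step2]; omega) main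
  refine ⟨?_, hfin.2⟩
  have := congrFun hfin.1 0
  simp only [z1, z2] at this
  omega
end

section
/- Let σ = (σ_n)_{n≥0} be a directive sequence of non-erasing morphisms σ_n: 𝒜_{n+1} → 𝒜_n⁺ such that each morphism σ_n satisfies one of: (i) the rank of the incidence matrix M_{σ_n} equals |𝒜_{n+1}|, or (ii) |𝒜_{n+1}| = 2, or (iii) σ_n is rotationally conjugate to a left permutative or right permutative morphism. Then σ is recognizable for aperiodic points: for every n ≥ 0, every aperiodic point y ∈ 𝒜_n^ℤ has at most one centered σ_n-representation (k,x) with x ∈ X^(n+1)_σ. -/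
open scoped BigOperators

namespace Recog

section Streams

variable {B : Type*}

/-- Streams that can be written as infinite products of words of `Y`. -/
def Par (Y : Set (List B)) (t : Stream' B) : Prop :=
  ∃ S : Set (Stream' B), t ∈ S ∧ ∀ t ∈ S, ∃ w ∈ Y, ∃ t' ∈ S, t = w ++ₛ t'

theorem Par.unfold {Y : Set (List B)} {t : Stream' B} (h : Par Y t) :
    ∃ w ∈ Y, ∃ t', Par Y t' ∧ t = w ++ₛ t' := by
  obtain ⟨S, ht, hS⟩ := h
  obtain ⟨w, hw, t', ht', e⟩ := hS t ht
  exact ⟨w, hw, t', ⟨S, ht', hS⟩, e⟩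

theorem Par.cons {Y : Set (List B)} {t : Stream' B} (h : Par Y t) {w : List B} (hw : w ∈ Y) :
    Par Y (w ++ₛ t) := by
  refine ⟨{t | Par Y t} ∪ {w ++ₛ t}, Or.inr rfl, ?_⟩
  rintro u (hu | hu)
  · obtain ⟨v, hv, t', ht', e⟩ := Par.unfold hu
    exact ⟨v, hv, t', Or.inl ht', e⟩
  · exact ⟨w, hw, t, Or.inl h, hu⟩

theorem Par.flatten {Y : Set (List B)} {t : Stream' B} (h : Par Y t) (l : List (List B))
    (hl : ∀ w ∈ l, w ∈ Y) : Par Y (l.flatten ++ₛ t) := by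
  induction l with
  | nil => simpa using h
  | cons w l ih =>
    rw [List.flatten_cons, Stream'.append_append_stream]
    exact Par.cons (ih fun v hv => hl v (by simp [hv])) (hl w (by simp))

theorem Par.expand {Y Y' : Set (List B)} {t : Stream' B} (h : Par Y' t)
    (hY : ∀ w ∈ Y', ∃ l : List (List B), l ≠ [] ∧ (∀ v ∈ l, v ∈ Y) ∧ l.flatten = w) :
    Par Y t := by
  refine ⟨{u | ∃ l : List (List B), ∃ t, (∀ v ∈ l, v ∈ Y) ∧ Par Y' t ∧ u = l.flatten ++ₛ t},
    ⟨[], t, by simp, h, by simp⟩, ?_⟩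
  have key : ∀ l : List (List B), l ≠ [] → (∀ v ∈ l, v ∈ Y) → ∀ t, Par Y' t →
      ∃ w ∈ Y, ∃ t' ∈ {u | ∃ l : List (List B), ∃ t, (∀ v ∈ l, v ∈ Y) ∧ Par Y' t ∧
        u = l.flatten ++ₛ t}, l.flatten ++ₛ t = w ++ₛ t' := by
    intro l hl hlY t ht
    cases l with
    | nil => exact absurd rfl hl
    | cons w l =>
      refine ⟨w, hlY w (by simp), l.flatten ++ₛ t,
        ⟨l, t, fun v hv => hlY v (by simp [hv]), ht, rfl⟩, ?_⟩
      rw [List.flatten_cons, Stream'.append_append_stream]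
  rintro u ⟨l, t, hl, ht, rfl⟩
  by_cases hn : l = []
  · subst hn
    obtain ⟨w, hw, t', ht', e⟩ := Par.unfold ht
    obtain ⟨l, hl0, hlY, hlw⟩ := hY w hw
    have := key l hl0 hlY t' ht'
    rw [hlw] at this
    simpa [e] using this
  · exact key l hn hl t ht

/-- `Y` is an ω-code. -/
def WCode (Y : Set (List B)) : Prop :=
  ∀ w ∈ Y, ∀ w' ∈ Y, ∀ t t', Par Y t → Par Y t' → w ++ₛ t = w' ++ₛ t' → w = w'

theorem wcode_singletons : WCode (Set.range fun b : B => [b]) := by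
  rintro _ ⟨b, rfl⟩ _ ⟨b', rfl⟩ t t' _ _ h
  have := congrArg Stream'.head h
  simpa using this

/-- `y0` repeated `k` times. -/
def pw (y0 : List B) (k : ℕ) : List B := (List.replicate k y0).flatten

/-- regrouped words. -/
def regr (Y : Set (List B)) (y0 : List B) : Set (List B) :=
  {z | ∃ w ∈ Y, w ≠ y0 ∧ ∃ k, z = w ++ pw y0 k}

theorem pw_add (y0 : List B) (j k : ℕ) : pw y0 (j + k) = pw y0 j ++ pw y0 k := by
  simp only [pw, List.replicate_add, List.flatten_append]

theorem pw_succ (y0 : List B) (k : ℕ) : pw y0 (k + 1) = y0 ++ pw y0 k := by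
  simp [pw, List.replicate_succ]

theorem par_regr {Y : Set (List B)} {y0 : List B} (h0 : y0 ∈ Y) {t : Stream' B}
    (h : Par (regr Y y0) t) : Par Y t := by
  refine h.expand ?_
  rintro _ ⟨w, hw, -, k, rfl⟩
  refine ⟨w :: List.replicate k y0, by simp, ?_, by simp [pw]⟩
  intro v hv
  rcases List.mem_cons.1 hv with rfl | hv
  · exact hw
  · rw [List.eq_of_mem_replicate hv]; exact h0

theorem par_pw {Y : Set (List B)} {y0 : List B} (h0 : y0 ∈ Y) {t : Stream' B} (h : Par Y t)
    (k : ℕ) : Par Y (pw y0 k ++ₛ t) :=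
  h.flatten _ fun v hv => by rw [List.eq_of_mem_replicate hv]; exact h0

theorem stream_cancel (w : List B) {s t : Stream' B} (h : w ++ₛ s = w ++ₛ t) : s = t :=
  Stream'.append_right_injective w s t h

theorem wcode_aux {Y : Set (List B)} (hY : WCode Y) {y0 : List B} (h0 : y0 ∈ Y)
    {t t' : Stream' B} (ht : Par (regr Y y0) t) (ht' : Par (regr Y y0) t') {k k' : ℕ}
    (h : pw y0 k ++ₛ t = pw y0 k' ++ₛ t') : k' ≤ k := by
  by_contra hlt
  obtain ⟨d, rfl⟩ : ∃ d, k' = k + (d + 1) := ⟨k' - k - 1, by omega⟩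
  rw [pw_add, Stream'.append_append_stream] at h
  have h := stream_cancel _ h
  rw [pw_succ, Stream'.append_append_stream] at h
  obtain ⟨_, ⟨w, hw, hne, j, rfl⟩, r, hr, e⟩ := ht.unfold
  rw [e, Stream'.append_append_stream] at h
  exact hne (hY w hw y0 h0 _ _ (par_pw h0 (par_regr h0 hr) j) (par_pw h0 (par_regr h0 ht') d) h)

theorem wcode_regr {Y : Set (List B)} (hY : WCode Y) {y0 : List B} (h0 : y0 ∈ Y) :
    WCode (regr Y y0) := by
  rintro _ ⟨w, hw, hne, k, rfl⟩ _ ⟨w', hw', hne', k', rfl⟩ t t' ht ht' h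
  rw [Stream'.append_append_stream, Stream'.append_append_stream] at h
  have e := hY w hw w' hw' _ _ (par_pw h0 (par_regr h0 ht) k) (par_pw h0 (par_regr h0 ht') k') h
  subst e
  have h := stream_cancel _ h
  have h1 := wcode_aux hY h0 ht ht' h
  have h2 := wcode_aux hY h0 ht' ht h.symm
  rw [le_antisymm h1 h2]

theorem regroup {Y : Set (List B)} (y0 : List B) (l : List (List B)) (hl : ∀ w ∈ l, w ∈ Y) :
    ∃ (k : ℕ) (l' : List (List B)), (∀ w ∈ l', w ∈ regr Y y0) ∧
      l.flatten = pw y0 k ++ l'.flatten ∧ (l.head? ≠ some y0 → k = 0) ∧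
      l'.length ≤ l.length ∧ (y0 ∈ l → l'.length < l.length) := by
  induction l with
  | nil => exact ⟨0, [], by simp, by simp [pw], by simp, by simp, by simp⟩
  | cons a l ih =>
    obtain ⟨k, l', h1, h2, h3, h4, h5⟩ := ih fun w hw => hl w (by simp [hw])
    by_cases ha : a = y0
    · subst ha
      refine ⟨k + 1, l', h1, ?_, by simp, ?_, ?_⟩
      · simp [pw_succ, h2]
      · simp; omega
      · simp; omega
    · refine ⟨0, (a ++ pw y0 k) :: l', ?_, ?_, by simp, ?_, ?_⟩
      · intro w hw
        rcases List.mem_cons.1 hw with rfl | hw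
        · exact ⟨a, hl a (by simp), ha, k, rfl⟩
        · exact h1 w hw
      · simp [pw, h2]
      · simpa using h4
      · intro h
        have : y0 ∈ l := by
          rcases List.mem_cons.1 h with h | h
          · exact absurd h.symm ha
          · exact h
        simpa using h5 this

theorem defect {I : Type*} [Fintype I] (φ : I → List B) (hφ : ∀ i, φ i ≠ []) :
    ∃ (Y : Set (List B)) (μ : I → List (List B)), WCode Y ∧ (∀ i, ∀ w ∈ μ i, w ∈ Y) ∧
      (∀ i, (μ i).flatten = φ i) ∧ ∀ i, ∀ w ∈ μ i, ∃ j, (μ j).head? = some w := by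
  classical
  let P : ℕ → Prop := fun n => ∃ (Y : Set (List B)) (μ : I → List (List B)), WCode Y ∧
    (∀ i, ∀ w ∈ μ i, w ∈ Y) ∧ (∀ i, (μ i).flatten = φ i) ∧ ∑ i, (μ i).length = n
  have hP : ∃ n, P n := by
    refine ⟨_, Set.range fun b : B => [b], fun i => (φ i).map fun b => [b], wcode_singletons,
      ?_, ?_, rfl⟩
    · intro i w hw
      obtain ⟨b, -, rfl⟩ := List.mem_map.1 hw
      exact ⟨b, rfl⟩
    · intro i
      show ((φ i).map fun b => [b]).flatten = φ i
      generalize φ i = l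
      induction l with
      | nil => rfl
      | cons a l ih => simpa using ih
  obtain ⟨Y, μ, hY, hμ, hfl, hsum⟩ := Nat.find_spec hP
  refine ⟨Y, μ, hY, hμ, hfl, ?_⟩
  by_contra hcon
  push Not at hcon
  obtain ⟨i0, y0, hy0, hno⟩ := hcon
  have h0 : y0 ∈ Y := hμ i0 y0 hy0
  choose k μ' h1 h2 h3 h4 h5 using fun i => regroup y0 (μ i) (hμ i)
  refine Nat.find_min hP (m := ∑ i, (μ' i).length) ?_ ⟨regr Y y0, μ', wcode_regr hY h0, h1, ?_, rfl⟩
  · rw [← hsum]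
    exact Finset.sum_lt_sum (fun i _ => h4 i) ⟨i0, Finset.mem_univ _, h5 i0 hy0⟩
  · intro i
    rw [← hfl i, h2 i, h3 i (hno i)]
    simp [pw]

/-- Determinism condition. -/
def Det {A : Type*} (σ : A → List B) : Prop :=
  ∀ (s : List B) (a b : A) (t1 t1' t2 t2' : Stream' B), s ≠ [] → Par (Set.range σ) t1 →
    Par (Set.range σ) t1' → Par (Set.range σ) t2 → Par (Set.range σ) t2' →
    s ++ₛ t1 = σ a ++ₛ t1' → s ++ₛ t2 = σ b ++ₛ t2' → a = b

theorem det_or_factor {A : Type*} [Fintype A] (σ : A → List B) (hσ : ∀ a, σ a ≠ []) :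
    Det σ ∨ ∃ (W : Finset (List B)) (μ : A → List (List B)), W.card < Fintype.card A ∧
      (∀ a, ∀ w ∈ μ a, w ∈ W) ∧ ∀ a, (μ a).flatten = σ a := by
  classical
  by_cases hD : Det σ
  · exact Or.inl hD
  right
  unfold Det at hD
  push Not at hD
  obtain ⟨s, a, b, t1, t1', t2, t2', hs, p1, p1', p2, p2', e1, e2, hab⟩ := hD
  let φ : Option A → List B := fun o => o.elim s σ
  have hφ : ∀ i, φ i ≠ [] := by
    rintro (_ | a)
    · exact hs
    · exact hσ a
  obtain ⟨Y, μ, hY, hμ, hfl, hhead⟩ := defect φ hφ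
  have hne : ∀ i, μ i ≠ [] := fun i h => hφ i (by rw [← hfl i, h]; rfl)
  have hpar : ∀ t, Par (Set.range σ) t → Par Y t := by
    intro t ht
    refine ht.expand ?_
    rintro _ ⟨a, rfl⟩
    exact ⟨μ (some a), hne _, hμ _, hfl (some a)⟩
  have hh : ∀ i j t t', Par (Set.range σ) t → Par (Set.range σ) t' →
      φ i ++ₛ t = φ j ++ₛ t' → (μ i).head? = (μ j).head? := by
    intro i j t t' ht ht' h
    rw [← hfl i, ← hfl j] at h
    have hi := hμ i
    have hj := hμ j
    have hni := hne i
    have hnj := hne j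
    revert h hi hj hni hnj
    cases μ i with
    | nil => intro _ _ _ h; exact absurd rfl h
    | cons u l =>
      cases μ j with
      | nil => intro _ _ _ _ h; exact absurd rfl h
      | cons v l' =>
        intro h hi hj _ _
        rw [List.flatten_cons, List.flatten_cons, Stream'.append_append_stream,
          Stream'.append_append_stream] at h
        have := hY u (hi u (by simp)) v (hj v (by simp)) _ _
          ((hpar t ht).flatten l fun w hw => hi w (by simp [hw]))
          ((hpar t' ht').flatten l' fun w hw => hj w (by simp [hw])) h
        simp [this]
  have ha := hh none (some a) _ _ p1 p1' e1
  have hb := hh none (some b) _ _ p2 p2' e2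
  let h : A → List B := fun a => ((μ (some a)).head?).getD []
  refine ⟨(Finset.univ.erase a).image h, fun a => μ (some a), ?_, ?_, fun a => hfl (some a)⟩
  · refine lt_of_le_of_lt Finset.card_image_le ?_
    rw [← Finset.card_univ]
    exact Finset.card_erase_lt_of_mem (Finset.mem_univ a)
  · intro c w hw
    obtain ⟨j, hj⟩ := hhead (some c) w hw
    have : ∃ d, d ≠ a ∧ (μ (some d)).head? = some w := by
      rcases j with _ | d
      · exact ⟨b, fun h => hab h.symm, by rw [← hb, hj]⟩
      · by_cases hd : d = a
        · subst hd
          exact ⟨b, fun h => hab h.symm, by rw [← hb, ha, hj]⟩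
        · exact ⟨d, hd, hj⟩
    obtain ⟨d, hd, hdw⟩ := this
    refine Finset.mem_image.2 ⟨d, by simp [hd], ?_⟩
    simp [h, hdw]

theorem det_of_leftPerm {A : Type*} (σ : A → List B) (hσ : ∀ a, σ a ≠ [])
    (h : LeftPermutative σ) : Det σ := by
  intro s a b t1 t1' t2 t2' hs _ _ _ _ e1 e2
  by_contra hab
  refine h a b hab ?_
  have ha := hσ a
  have hb := hσ b
  revert e1 e2 ha hb
  cases s with
  | nil => exact absurd rfl hs
  | cons u s =>
    cases σ a with
    | nil => intro _ _ h; exact absurd rfl h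
    | cons v l =>
      cases σ b with
      | nil => intro _ _ _ h; exact absurd rfl h
      | cons w l' =>
        intro e1 e2 _ _
        have h1 := congrArg Stream'.head e1
        have h2 := congrArg Stream'.head e2
        simp at h1 h2
        simp [← h1, ← h2]

theorem rank_lt_of_factor {A : Type*} [Fintype A] [Fintype B] [DecidableEq B] (σ : A → List B)
    (W : Finset (List B)) (μ : A → List (List B)) (hc : W.card < Fintype.card A)
    (hW : ∀ a, ∀ w ∈ μ a, w ∈ W) (hfl : ∀ a, (μ a).flatten = σ a) :
    (incidence σ).rank < Fintype.card A := by
  classical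
  let P : Matrix B W ℚ := Matrix.of fun b w => (w.1.count b : ℚ)
  let Q : Matrix W A ℚ := Matrix.of fun w a => ((μ a).count w.1 : ℚ)
  have : incidence σ = P * Q := by
    ext b a
    simp only [incidence, Matrix.of_apply, Matrix.mul_apply, P, Q]
    rw [← hfl a, List.count_flatten]
    rw [Finset.sum_coe_sort W (fun w => (w.count b : ℚ) * ((μ a).count w : ℚ))]
    have hs : ∀ l : List (List B), (∀ w ∈ l, w ∈ W) →
        (((l.map (List.count b)).sum : ℕ) : ℚ) = ∑ w ∈ W, (w.count b : ℚ) * (l.count w : ℚ) := by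
      intro l
      induction l with
      | nil => simp
      | cons v l ih =>
        intro hl
        have hv : v ∈ W := hl v (by simp)
        rw [List.map_cons, List.sum_cons, Nat.cast_add, ih fun w hw => hl w (by simp [hw])]
        simp only [List.count_cons, Nat.cast_add, mul_add, Finset.sum_add_distrib]
        rw [add_comm]
        congr 1
        simp [hv]
    exact hs (μ a) (hW a)
  rw [this]
  calc (P * Q).rank ≤ P.rank := Matrix.rank_mul_le_left P Q
    _ ≤ Fintype.card W := Matrix.rank_le_card_width P
    _ = W.card := Fintype.card_coe W
    _ < _ := hc

end Streams

end Recog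

namespace Recog

section Parse

variable {A B : Type*}

/-- A parsing of `y` into `σ`-blocks `σ (x ℓ)` located at `c ℓ`. -/
structure IsParse (σ : A → List B) (y : ℤ → B) (c : ℤ → ℤ) (x : ℤ → A) : Prop where
  step : ∀ ℓ, c (ℓ + 1) = c ℓ + (σ (x ℓ)).length
  val : ∀ ℓ (j : ℕ), j < (σ (x ℓ)).length → (σ (x ℓ))[j]? = some (y (c ℓ + j))

/-- The right tail of `y` at `m`. -/
def tl (y : ℤ → B) (m : ℤ) : Stream' B := fun j => y (m + j)

theorem tl_append (y : ℤ → B) (w : List B) (m : ℤ)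
    (h : ∀ j : ℕ, j < w.length → w[j]? = some (y (m + j))) :
    tl y m = w ++ₛ tl y (m + w.length) := by
  induction w generalizing m with
  | nil => simp
  | cons b w ih =>
    have h0 := h 0 (by simp)
    have h1 := ih (m + 1) fun j hj => by
      have := h (j + 1) (by simpa using hj)
      simp only [List.getElem?_cons_succ] at this
      rw [this]
      congr 2
      push_cast
      ring
    have e : m + ((b :: w).length : ℤ) = m + 1 + w.length := by
      simp only [List.length_cons]; push_cast; ring
    rw [e, Stream'.cons_append_stream, ← h1]
    funext j
    cases j with
    | zero =>
      simp at h0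
      show y (m + (0 : ℕ)) = b
      simp [h0]
    | succ j =>
      show y (m + ((j + 1 : ℕ) : ℤ)) = y (m + 1 + j)
      congr 1
      push_cast
      ring

section
variable {σ : A → List B} {y : ℤ → B} {c : ℤ → ℤ} {x : ℤ → A}

theorem IsParse.strictMono (hσ : NonErasing σ) (h : IsParse σ y c x) : StrictMono c := by
  refine strictMono_int_of_lt_succ fun ℓ => ?_
  have := List.length_pos_iff.2 (hσ (x ℓ))
  have := h.step ℓ
  omega

theorem IsParse.lower (hσ : NonErasing σ) (h : IsParse σ y c x) (n : ℕ) :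
    c 0 + n ≤ c n ∧ c (-n) ≤ c 0 - n := by
  have hm := h.strictMono hσ
  induction n with
  | zero => simp
  | succ n ih =>
    have h1 := hm (show (n : ℤ) < ((n + 1 : ℕ) : ℤ) by push_cast; omega)
    have h2 := hm (show -((n + 1 : ℕ) : ℤ) < -(n : ℤ) by push_cast; omega)
    omega

theorem IsParse.cov (hσ : NonErasing σ) (h : IsParse σ y c x) (m : ℤ) :
    ∃ ℓ, c ℓ ≤ m ∧ m < c (ℓ + 1) := by
  have hm := h.strictMono hσ
  obtain ⟨ℓ, h1, h2⟩ := Int.exists_greatest_of_bdd (P := fun ℓ => c ℓ ≤ m)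
    ⟨((m - c 0).toNat + 1 : ℕ), fun z hz => by
      by_contra hlt
      have := hm (not_le.1 hlt)
      have := (h.lower hσ ((m - c 0).toNat + 1)).1
      omega⟩
    ⟨-((c 0 - m).toNat : ℤ), by
      have := (h.lower hσ (c 0 - m).toNat).2
      omega⟩
  refine ⟨ℓ, h1, ?_⟩
  by_contra hlt
  have := h2 (ℓ + 1) (not_lt.1 hlt)
  omega

theorem IsParse.tail (h : IsParse σ y c x) (ℓ : ℤ) :
    tl y (c ℓ) = σ (x ℓ) ++ₛ tl y (c (ℓ + 1)) := by
  rw [h.step ℓ]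
  exact tl_append y _ _ (h.val ℓ)

theorem IsParse.par (h : IsParse σ y c x) (ℓ : ℤ) : Par (Set.range σ) (tl y (c ℓ)) := by
  refine ⟨{t | ∃ ℓ, t = tl y (c ℓ)}, ⟨ℓ, rfl⟩, ?_⟩
  rintro _ ⟨ℓ, rfl⟩
  exact ⟨σ (x ℓ), ⟨_, rfl⟩, _, ⟨ℓ + 1, rfl⟩, h.tail ℓ⟩

/-- Residual words of a parsing. -/
structure Res (σ : A → List B) (y : ℤ → B) (c : ℤ → ℤ) (x : ℤ → A) (r : ℤ → List B) :
    Prop where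
  mem : ∀ m, ∃ a, r m <:+ σ a
  int : ∀ m, m + 1 ∉ Set.range c → r m = y m :: r (m + 1)
  fin : ∀ m, m + 1 ∈ Set.range c → r m = [y m]
  cutp : ∀ ℓ, r (c ℓ) = σ (x ℓ)
  par : ∀ m, ∃ t, Par (Set.range σ) t ∧ tl y m = r m ++ₛ t

theorem IsParse.res (hσ : NonErasing σ) (h : IsParse σ y c x) : ∃ r, Res σ y c x r := by
  have hm := h.strictMono hσ
  choose f h1 h2 using h.cov hσ
  have uniq : ∀ m ℓ, c ℓ ≤ m → m < c (ℓ + 1) → f m = ℓ := by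
    intro m ℓ ha hb
    have a1 := hm.lt_iff_lt.1 (lt_of_le_of_lt (h1 m) hb)
    have a2 := hm.lt_iff_lt.1 (lt_of_le_of_lt ha (h2 m))
    omega
  have hval : ∀ m, ∀ i : ℕ, m + i < c (f m + 1) →
      (σ (x (f m)))[(m - c (f m)).toNat + i]? = some (y (m + i)) := by
    intro m i hi
    have a := h1 m
    have b := h.step (f m)
    rw [h.val (f m) _ (by omega)]
    congr 2
    omega
  have hlen : ∀ m, ((σ (x (f m))).drop (m - c (f m)).toNat).length = c (f m + 1) - m := by
    intro m
    have a := h1 m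
    have a' := h2 m
    have b := h.step (f m)
    rw [List.length_drop]
    omega
  have hcons : ∀ m, (σ (x (f m))).drop (m - c (f m)).toNat =
      y m :: (σ (x (f m))).drop ((m - c (f m)).toNat + 1) := by
    intro m
    have a := h1 m
    have a' := h2 m
    have b := h.step (f m)
    rw [List.drop_eq_getElem_cons (by omega)]
    congr 1
    have := hval m 0 (by simpa using a')
    simp only [Nat.cast_zero, add_zero] at this
    exact (List.getElem?_eq_some_iff.1 this).2
  refine ⟨fun m => (σ (x (f m))).drop (m - c (f m)).toNat, ?_, ?_, ?_, ?_, ?_⟩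
  · exact fun m => ⟨_, List.drop_suffix _ _⟩
  · intro m hn
    have a := h1 m
    have a' := h2 m
    have hlt : m + 1 < c (f m + 1) := by
      rcases lt_or_eq_of_le (show m + 1 ≤ c (f m + 1) by omega) with h | h
      · exact h
      · exact absurd ⟨_, h.symm⟩ hn
    have e := uniq (m + 1) (f m) (by omega) hlt
    show (σ (x (f m))).drop (m - c (f m)).toNat =
      y m :: (σ (x (f (m + 1)))).drop (m + 1 - c (f (m + 1))).toNat
    rw [hcons m, e]
    congr 2
    omega
  · rintro m ⟨ℓ, hℓ⟩
    have a := h1 m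
    have a' := h2 m
    have e : m + 1 = c (f m + 1) := by
      by_contra hne
      have b1 := hm.lt_iff_lt.1 (show c (f m) < c ℓ by omega)
      have b2 := hm.lt_iff_lt.1 (show c ℓ < c (f m + 1) by omega)
      omega
    show (σ (x (f m))).drop (m - c (f m)).toNat = [y m]
    have hl := hlen m
    rw [hcons m] at hl ⊢
    rw [List.length_cons] at hl
    congr 1
    apply List.eq_nil_of_length_eq_zero
    omega
  · intro ℓ
    show (σ (x (f (c ℓ)))).drop (c ℓ - c (f (c ℓ))).toNat = _
    rw [uniq (c ℓ) ℓ le_rfl (hm (by omega))]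
    simp
  · intro m
    refine ⟨_, h.par (f m + 1), ?_⟩
    show tl y m = (σ (x (f m))).drop (m - c (f m)).toNat ++ₛ _
    have e := tl_append y ((σ (x (f m))).drop (m - c (f m)).toNat) m fun j hj => by
      rw [List.getElem?_drop]
      have hl := hlen m
      exact hval m j (by omega)
    rw [e, hlen m]
    congr 2
    ring

theorem Res.ne_nil {r : ℤ → List B} (h : Res σ y c x r) (m : ℤ) : r m ≠ [] := by
  by_cases hm : m + 1 ∈ Set.range c
  · simp [h.fin m hm]
  · simp [h.int m hm]

theorem Res.head {r : ℤ → List B} (h : Res σ y c x r) (m : ℤ) : (r m).head? = some (y m) := by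
  by_cases hm : m + 1 ∈ Set.range c
  · simp [h.fin m hm]
  · simp [h.int m hm]

theorem Res.cut_iff {r : ℤ → List B} (h : Res σ y c x r) (m n : ℤ) (e : r m = r n)
    (hm : m + 1 ∈ Set.range c) : n + 1 ∈ Set.range c := by
  by_contra hn
  rw [h.fin m hm, h.int n hn] at e
  simp only [List.cons.injEq] at e
  exact h.ne_nil _ e.2.symm

theorem Res.int_eq {r : ℤ → List B} (h : Res σ y c x r) (m n : ℤ) (e : r m = r n)
    (hm : m + 1 ∉ Set.range c) : r (m + 1) = r (n + 1) := by
  have hn : n + 1 ∉ Set.range c := fun hn => hm (h.cut_iff n m e.symm hn)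
  rw [h.int m hm, h.int n hn] at e
  simp only [List.cons.injEq] at e
  exact e.2

theorem Res.det_aux (hD : Det σ) {c' : ℤ → ℤ} {x' : ℤ → A} {r r' : ℤ → List B}
    (hp : IsParse σ y c x) (h : Res σ y c x r) (h' : Res σ y c' x' r') (m n : ℤ)
    (hm : m ∈ Set.range c) (hn : n ∈ Set.range c) (e : r' m = r' n) : r m = r n := by
  obtain ⟨ℓ, rfl⟩ := hm
  obtain ⟨ℓ', rfl⟩ := hn
  rw [h.cutp, h.cutp]
  obtain ⟨t1, p1, e1⟩ := h'.par (c ℓ)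
  obtain ⟨t2, p2, e2⟩ := h'.par (c ℓ')
  rw [← e] at e2
  rw [hp.tail] at e1 e2
  rw [hD _ _ _ _ _ _ _ (h'.ne_nil _) p1 (hp.par _) p2 (hp.par _) e1.symm e2.symm]

theorem Res.det (hD : Det σ) {c' : ℤ → ℤ} {x' : ℤ → A} {r r' : ℤ → List B}
    (hp : IsParse σ y c x) (hp' : IsParse σ y c' x')
    (h : Res σ y c x r) (h' : Res σ y c' x' r') (m n : ℤ)
    (hm : ¬(m + 1 ∈ Set.range c ∧ m + 1 ∈ Set.range c')) (e : r m = r n) (e' : r' m = r' n) :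
    r (m + 1) = r (n + 1) ∧ r' (m + 1) = r' (n + 1) ∧
      ¬(n + 1 ∈ Set.range c ∧ n + 1 ∈ Set.range c') := by
  refine ⟨?_, ?_, fun hn => hm ⟨h.cut_iff n m e.symm hn.1, h'.cut_iff n m e'.symm hn.2⟩⟩
  · by_cases h1 : m + 1 ∈ Set.range c
    · have h2 : m + 1 ∉ Set.range c' := fun h2 => hm ⟨h1, h2⟩
      exact Res.det_aux hD hp h h' _ _ h1 (h.cut_iff m n e h1) (h'.int_eq m n e' h2)
    · exact h.int_eq m n e h1
  · by_cases h1 : m + 1 ∈ Set.range c'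
    · have h2 : m + 1 ∉ Set.range c := fun h2 => hm ⟨h2, h1⟩
      exact Res.det_aux hD hp' h' h _ _ h1 (h'.cut_iff m n e' h1) (h.int_eq m n e h2)
    · exact h'.int_eq m n e' h1

theorem Res.prop (hD : Det σ) {c' : ℤ → ℤ} {x' : ℤ → A} {r r' : ℤ → List B}
    (hp : IsParse σ y c x) (hp' : IsParse σ y c' x')
    (h : Res σ y c x r) (h' : Res σ y c' x' r') (i : ℤ) (p : ℕ) (hpp : 1 ≤ p)
    (hc : ∀ m, i < m → m ≤ i + p → ¬(m ∈ Set.range c ∧ m ∈ Set.range c'))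
    (e : r i = r (i + p)) (e' : r' i = r' (i + p)) (t : ℕ) :
    r (i + t) = r (i + p + t) ∧ r' (i + t) = r' (i + p + t) ∧
      ¬(i + t + 1 ∈ Set.range c ∧ i + t + 1 ∈ Set.range c') := by
  induction t using Nat.strong_induction_on with
  | _ t ih =>
    have hcom : ¬(i + t + 1 ∈ Set.range c ∧ i + t + 1 ∈ Set.range c') := by
      by_cases htp : t < p
      · exact hc _ (by omega) (by omega)
      · obtain ⟨a1, a2, a3⟩ := ih (t - p) (by omega)
        have := (Res.det hD hp hp' h h' _ _ a3 a1 a2).2.2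
        have e : i + p + ((t - p : ℕ) : ℤ) + 1 = i + t + 1 := by omega
        rwa [e] at this
    cases t with
    | zero => exact ⟨by simpa using e, by simpa using e', hcom⟩
    | succ t =>
      obtain ⟨a1, a2, a3⟩ := ih t (by omega)
      obtain ⟨b1, b2, -⟩ := Res.det hD hp hp' h h' _ _ a3 a1 a2
      have e1 : i + ((t + 1 : ℕ) : ℤ) = i + t + 1 := by push_cast; ring
      have e2 : i + p + ((t + 1 : ℕ) : ℤ) = i + p + t + 1 := by push_cast; ring
      rw [e2, e1]
      rw [e1] at hcom
      exact ⟨b1, b2, hcom⟩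

theorem exists_common [Finite A] (hσ : NonErasing σ) (hD : Det σ) (hy : Aperiodic y)
    {c' : ℤ → ℤ} {x' : ℤ → A} (hp : IsParse σ y c x) (hp' : IsParse σ y c' x') (M : ℤ) :
    ∃ m ≤ M, m ∈ Set.range c ∧ m ∈ Set.range c' := by
  classical
  by_contra hno
  push Not at hno
  obtain ⟨r, h⟩ := hp.res hσ
  obtain ⟨r', h'⟩ := hp'.res hσ
  have hfin : {s : List B | ∃ a, s <:+ σ a}.Finite := by
    have : {s : List B | ∃ a, s <:+ σ a} = ⋃ a, {s | s ∈ (σ a).tails} := by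
      ext s; simp
    rw [this]
    exact Set.finite_iUnion fun a => List.finite_toSet _
  let F := hfin.toFinset ×ˢ hfin.toFinset
  let N := F.card
  have hF : ∀ m, (r m, r' m) ∈ F := by
    intro m
    simp only [F, Finset.mem_product, Set.Finite.mem_toFinset, Set.mem_ofPred_eq]
    exact ⟨h.mem m, h'.mem m⟩
  refine hy N.factorial (Nat.succ_le_of_lt (Nat.factorial_pos _)) ?_
  funext z
  -- a base point far to the left
  obtain ⟨b, hb1, hb2⟩ : ∃ b : ℤ, b + N ≤ M ∧ b + N ≤ z := ⟨min M z - N, by omega, by omega⟩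
  obtain ⟨i, hi, j, hj, hij, e⟩ := Finset.exists_ne_map_eq_of_card_lt_of_maps_to
    (s := Finset.range (N + 1)) (t := F) (by simp [N])
    (f := fun i : ℕ => (r (b + i), r' (b + i))) (fun i _ => hF _)
  have main : ∀ i j : ℕ, i < j → j < N + 1 → r (b + i) = r (b + j) → r' (b + i) = r' (b + j) →
      y (z + N.factorial) = y z := by
    intro i j hlt hjN e e'
    obtain ⟨p, rfl⟩ : ∃ p, j = i + p := ⟨j - i, by omega⟩
    have q := Res.prop hD hp hp' h h' (b + i) p (by omega)
      (fun m _ hm hcc => hno m (by omega) hcc.1 hcc.2)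
      (by rw [e]; congr 1; push_cast; ring) (by rw [e']; congr 1; push_cast; ring)
    have hper : ∀ m : ℤ, b + i ≤ m → y (m + p) = y m := by
      intro m hm
      obtain ⟨t, ht⟩ := Int.eq_ofNat_of_zero_le (show 0 ≤ m - (b + i) by omega)
      have := (q t).1
      have e1 : b + i + (t : ℤ) = m := by omega
      have e2 : b + i + p + (t : ℤ) = m + p := by omega
      rw [e1, e2] at this
      have h1 := h.head m
      have h2 := h.head (m + p)
      rw [← this, h1] at h2
      exact (Option.some.inj h2).symm
    have hmul : ∀ k : ℕ, y (z + (k * p : ℕ)) = y z := by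
      intro k
      induction k with
      | zero => simp
      | succ k ih =>
        rw [← ih, ← hper (z + (k * p : ℕ)) (by
          have : (0 : ℤ) ≤ ((k * p : ℕ) : ℤ) := Int.natCast_nonneg _
          omega)]
        congr 1
        push_cast
        ring
    obtain ⟨k, hk⟩ := Nat.dvd_factorial (show 0 < p by omega) (show p ≤ N by omega)
    rw [hk, mul_comm]
    exact hmul k
  simp only [Prod.mk.injEq] at e
  rw [Finset.mem_range] at hi hj
  rcases lt_or_gt_of_ne hij with hlt | hlt
  · exact main i j hlt hj e.1 e.2
  · exact main j i hlt hi e.1.symm e.2.symm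

end

/-- Any two parsings of `y` have the same blocks at the same places. -/
def RecP (σ : A → List B) (y : ℤ → B) : Prop :=
  ∀ c x c' x', IsParse σ y c x → IsParse σ y c' x' → ∀ ℓ, ∃ ℓ', c' ℓ' = c ℓ ∧ x' ℓ' = x ℓ

theorem recP_of_det [Finite A] {σ : A → List B} (hσ : NonErasing σ) (hD : Det σ) {y : ℤ → B}
    (hy : Aperiodic y) : RecP σ y := by
  intro c x c' x' hp hp' ℓ
  have hm := hp.strictMono hσ
  obtain ⟨m, hmM, ⟨l0, rfl⟩, ⟨l0', hl0⟩⟩ := exists_common hσ hD hy hp hp' (c ℓ)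
  have step : ∀ ℓ ℓ', c' ℓ' = c ℓ → x' ℓ' = x ℓ := by
    intro ℓ ℓ' e
    have h1 := hp.tail ℓ
    have h2 := hp'.tail ℓ'
    rw [e, h1] at h2
    exact (hD (σ (x ℓ)) _ _ _ _ _ _ (hσ _) (hp.par ℓ) (hp.par ℓ) (hp.par _) (hp'.par _) rfl
      h2).symm
  have ind : ∀ n : ℕ, c' (l0' + n) = c (l0 + n) := by
    intro n
    induction n with
    | zero => simpa using hl0
    | succ n ih =>
      have e1 : l0 + ((n + 1 : ℕ) : ℤ) = l0 + n + 1 := by push_cast; ring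
      have e2 : l0' + ((n + 1 : ℕ) : ℤ) = l0' + n + 1 := by push_cast; ring
      rw [e1, e2, hp.step, hp'.step, ih, step _ _ ih]
  have hle := hm.le_iff_le.1 hmM
  have e := ind (ℓ - l0).toNat
  have e1 : l0 + ((ℓ - l0).toNat : ℤ) = ℓ := by omega
  rw [e1] at e
  exact ⟨_, e, step _ _ e⟩

end Parse

end Recog

namespace Recog

section Final

variable {A B : Type*}

theorem IsParse.rev {σ : A → List B} {y : ℤ → B} {c : ℤ → ℤ} {x : ℤ → A}
    (h : IsParse σ y c x) :
    IsParse (fun a => (σ a).reverse) (fun m => y (-1 - m)) (fun ℓ => -c (-ℓ))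
      (fun ℓ => x (-1 - ℓ)) := by
  have hs : ∀ ℓ, c (-ℓ) = c (-1 - ℓ) + (σ (x (-1 - ℓ))).length := by
    intro ℓ
    rw [← h.step]
    congr 1
    ring
  constructor
  · intro ℓ
    have := hs ℓ
    have e : -(ℓ + 1) = -1 - ℓ := by ring
    simp only [List.length_reverse, e]
    omega
  · intro ℓ j hj
    simp only [List.length_reverse] at hj
    rw [List.getElem?_reverse hj, h.val _ _ (by omega)]
    have := hs ℓ
    congr 2
    omega

theorem Aperiodic.rev {y : ℤ → B} (h : Aperiodic y) : Aperiodic fun m => y (-1 - m) := by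
  intro p hp e
  refine h p hp ?_
  funext m
  have := congrFun e (-1 - m - p)
  simp only at this
  ring_nf at this ⊢
  exact this.symm

theorem recP_of_rev {σ : A → List B} {y : ℤ → B}
    (h : RecP (fun a => (σ a).reverse) fun m => y (-1 - m)) : RecP σ y := by
  intro c x c' x' hp hp' ℓ
  obtain ⟨l, h1, h2⟩ := h _ _ _ _ hp.rev hp'.rev (-1 - ℓ)
  have e : -1 - (-1 - ℓ) = ℓ := by ring
  simp only [e] at h1 h2
  refine ⟨-1 - l, ?_, h2⟩
  have s1 := hp.step ℓ
  have s2 := hp'.step (-1 - l)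
  have e1 : -(-1 - ℓ) = ℓ + 1 := by ring
  have e2 : -1 - l + 1 = -l := by ring
  rw [e1] at h1
  rw [e2, h2] at s2
  omega

theorem IsParse.conj {σ σ' : A → List B} (hσ : NonErasing σ) {w : List B}
    (hw : ∀ a, σ a ++ w = w ++ σ' a)
    {y : ℤ → B} {c : ℤ → ℤ} {x : ℤ → A} (h : IsParse σ y c x) :
    IsParse σ' y (fun ℓ => c ℓ + w.length) x := by
  have hlen : ∀ a, (σ a).length = (σ' a).length := by
    intro a
    have := congrArg List.length (hw a)
    simp only [List.length_append] at this
    omega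
  have key : ∀ (j : ℕ) (ℓ : ℤ), j < w.length → w[j]? = some (y (c ℓ + j)) := by
    intro j
    induction j using Nat.strong_induction_on with
    | _ j ih =>
      intro ℓ hj
      have e : (w ++ σ' (x ℓ))[j]? = w[j]? := List.getElem?_append_left hj
      rw [← e, ← hw]
      by_cases hjl : j < (σ (x ℓ)).length
      · rw [List.getElem?_append_left hjl, h.val ℓ j hjl]
      · have hpos := List.length_pos_iff.2 (hσ (x ℓ))
        have hst := h.step ℓ
        rw [List.getElem?_append_right (by omega), ih _ (by omega) (ℓ + 1) (by omega)]
        congr 2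
        omega
  constructor
  · intro ℓ
    have := h.step ℓ
    have := hlen (x ℓ)
    show c (ℓ + 1) + w.length = c ℓ + w.length + (σ' (x ℓ)).length
    omega
  · intro ℓ j hj
    have hl := hlen (x ℓ)
    have hst := h.step ℓ
    have e : (w ++ σ' (x ℓ))[w.length + j]? = (σ' (x ℓ))[j]? := by
      rw [List.getElem?_append_right (by omega)]
      congr 1
      omega
    rw [← e, ← hw]
    by_cases hjl : w.length + j < (σ (x ℓ)).length
    · rw [List.getElem?_append_left hjl, h.val ℓ _ hjl]
      congr 2
      push_cast
      ring
    · rw [List.getElem?_append_right (by omega), key _ (ℓ + 1) (by omega)]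
      congr 2
      omega

theorem recP_of_conj {σ σ' : A → List B} (hσ : NonErasing σ) {w : List B}
    (hw : ∀ a, σ a ++ w = w ++ σ' a) {y : ℤ → B} (h : RecP σ' y) : RecP σ y := by
  intro c x c' x' hp hp' ℓ
  obtain ⟨l, h1, h2⟩ := h _ _ _ _ (hp.conj hσ hw) (hp'.conj hσ hw) ℓ
  exact ⟨l, by simpa using h1, h2⟩

theorem nonErasing_rev {σ : A → List B} (h : NonErasing σ) :
    NonErasing fun a => (σ a).reverse := fun a => by simpa using h a

theorem recP_perm [Finite A] {σ : A → List B} (hσ : NonErasing σ)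
    (hP : LeftPermutative σ ∨ RightPermutative σ) {y : ℤ → B} (hy : Aperiodic y) : RecP σ y := by
  rcases hP with hP | hP
  · exact recP_of_det hσ (det_of_leftPerm σ hσ hP) hy
  · refine recP_of_rev (recP_of_det (nonErasing_rev hσ)
      (det_of_leftPerm _ (nonErasing_rev hσ) ?_) hy.rev)
    intro a b hab
    simpa using hP a b hab

theorem recP_rotConj [Finite A] {σ σ' : A → List B} (hσ : NonErasing σ) (hσ' : NonErasing σ')
    (hr : RotConj σ σ') (hP : LeftPermutative σ' ∨ RightPermutative σ') {y : ℤ → B}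
    (hy : Aperiodic y) : RecP σ y := by
  obtain ⟨w, hw | hw⟩ := hr
  · exact recP_of_conj hσ hw (recP_perm hσ' hP hy)
  · refine recP_of_rev (recP_of_conj (nonErasing_rev hσ) (w := w.reverse)
      (σ' := fun a => (σ' a).reverse) ?_ (recP_perm (nonErasing_rev hσ') ?_ hy.rev))
    · intro a
      have := congrArg List.reverse (hw a)
      simpa using this
    · rcases hP with hP | hP
      · right
        intro a b hab
        simpa using hP a b hab
      · left
        intro a b hab
        simpa using hP a b hab

theorem pw_length (w : List B) (n : ℕ) : (pw w n).length = n * w.length := by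
  simp [pw]

theorem pw_get (w : List B) (n j : ℕ) (hj : j < n * w.length) :
    (pw w n)[j]? = w[j % w.length]? := by
  induction n generalizing j with
  | zero => simp at hj
  | succ n ih =>
    rw [pw_succ]
    by_cases h : j < w.length
    · rw [List.getElem?_append_left h, Nat.mod_eq_of_lt h]
    · push Not at h
      rw [List.getElem?_append_right h, ih, ← Nat.mod_eq_sub_mod h]
      rw [Nat.succ_mul] at hj
      omega

theorem not_aperiodic_of_factor {σ : A → List B} (hσ : NonErasing σ) {y : ℤ → B} {c : ℤ → ℤ}
    {x : ℤ → A} (h : IsParse σ y c x) (w : List B) (n : A → ℕ) (hw : ∀ a, σ a = pw w (n a)) :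
    ¬ Aperiodic y := by
  intro hy
  have hlen : ∀ a, (σ a).length = n a * w.length := fun a => by rw [hw, pw_length]
  have hpos : ∀ a, 0 < n a * w.length := fun a => by
    rw [← hlen]; exact List.length_pos_iff.2 (hσ a)
  have hw0 : 0 < w.length := Nat.pos_of_mul_pos_left (hpos (x 0))
  have hv : ∀ ℓ (j : ℕ), j < n (x ℓ) * w.length → some (y (c ℓ + j)) = w[j % w.length]? := by
    intro ℓ j hj
    rw [← h.val ℓ j (by rw [hlen]; exact hj), hw, pw_get _ _ _ hj]
  refine hy w.length hw0 ?_
  funext m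
  obtain ⟨ℓ, h1, h2⟩ := h.cov hσ m
  obtain ⟨j, hj⟩ := Int.eq_ofNat_of_zero_le (show 0 ≤ m - c ℓ by omega)
  have hst := h.step ℓ
  rw [hlen] at hst
  have hjl : j < n (x ℓ) * w.length := by omega
  have hm : m = c ℓ + j := by omega
  apply Option.some.inj
  subst hm
  rw [hv ℓ j hjl]
  by_cases hb : j + w.length < n (x ℓ) * w.length
  · have := hv ℓ (j + w.length) hb
    rw [Nat.add_mod_right] at this
    rw [← this]
    congr 2
    push_cast
    ring
  · have hp := hpos (x (ℓ + 1))
    have hge : w.length ≤ n (x (ℓ + 1)) * w.length :=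
      Nat.le_mul_of_pos_left _ (Nat.pos_of_mul_pos_right hp)
    have := hv (ℓ + 1) (j + w.length - n (x ℓ) * w.length) (by omega)
    have e : (j + w.length - n (x ℓ) * w.length) % w.length = j % w.length := by
      rw [← Nat.add_mul_mod_self_right _ (n (x ℓ)), Nat.sub_add_cancel (by omega),
        Nat.add_mod_right]
    rw [e] at this
    rw [← this]
    congr 2
    omega

theorem recP_main [Fintype A] [Fintype B] [DecidableEq B] {σ : A → List B} (hσ : NonErasing σ)
    (hc : (incidence σ).rank = Fintype.card A ∨ Fintype.card A = 2 ∨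
      ∃ σ' : A → List B, NonErasing σ' ∧ RotConj σ σ' ∧
        (LeftPermutative σ' ∨ RightPermutative σ')) {y : ℤ → B} (hy : Aperiodic y) :
    RecP σ y := by
  rcases hc with hc | hc | ⟨σ', h1, h2, h3⟩
  · rcases det_or_factor σ hσ with hD | ⟨W, μ, hW, hμ, hfl⟩
    · exact recP_of_det hσ hD hy
    · exact absurd hc (rank_lt_of_factor σ W μ hW hμ hfl).ne
  · rcases det_or_factor σ hσ with hD | ⟨W, μ, hW, hμ, hfl⟩
    · exact recP_of_det hσ hD hy
    · intro c x c' x' hp hp' ℓ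
      exfalso
      obtain ⟨w, hw⟩ : ∃ w, ∀ v ∈ W, v = w := by
        have : W.card ≤ 1 := by omega
        rcases W.eq_empty_or_nonempty with rfl | ⟨w, hw⟩
        · exact ⟨[], by simp⟩
        · exact ⟨w, fun v hv => Finset.card_le_one.1 this v hv w hw⟩
      refine not_aperiodic_of_factor hσ hp w (fun a => (μ a).length) (fun a => ?_) hy
      rw [← hfl a, pw]
      congr 1
      exact List.eq_replicate_iff.2 ⟨rfl, fun v hv => hw v (hμ a v hv)⟩
  · exact recP_rotConj hσ h1 h2 h3 hy

theorem cut_succ (σ : A → List B) (x : ℤ → A) (ℓ : ℤ) :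
    cut σ x (ℓ + 1) = cut σ x ℓ + (σ (x ℓ)).length := by
  unfold cut
  by_cases h : 0 ≤ ℓ
  · obtain ⟨n, rfl⟩ := Int.eq_ofNat_of_zero_le h
    rw [if_pos (by omega), if_pos h]
    have e : ((n : ℤ) + 1).toNat = n + 1 := by omega
    rw [e, Int.toNat_natCast, Finset.sum_range_succ]
  · obtain ⟨n, hn⟩ := Int.eq_ofNat_of_zero_le (show 0 ≤ -ℓ - 1 by omega)
    have hl : ℓ = -(n : ℤ) - 1 := by omega
    subst hl
    rw [if_neg h]
    have e : (-(-(n : ℤ) - 1)).toNat = n + 1 := by omega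
    rw [e, Finset.sum_range_succ]
    by_cases h0 : n = 0
    · subst h0
      simp
    · rw [if_neg (by omega)]
      have e : (-(-(n : ℤ) - 1 + 1)).toNat = n := by omega
      rw [e]
      ring

theorem IsRep.parse {σ : A → List B} {y : ℤ → B} {k : ℤ} {x : ℤ → A} (h : IsRep σ y k x) :
    IsParse σ y (fun ℓ => cut σ x ℓ - k) x := by
  constructor
  · intro ℓ
    simp only [cut_succ]
    ring
  · intro ℓ j hj
    have := h ℓ j hj
    rw [List.getElem?_eq_getElem hj]
    simp only [List.get_eq_getElem] at this
    rw [← this]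
    congr 2
    ring

theorem parse_eq {σ : A → List B} (hσ : NonErasing σ) {y : ℤ → B} (h : RecP σ y)
    {c c' : ℤ → ℤ} {x x' : ℤ → A} (hp : IsParse σ y c x) (hp' : IsParse σ y c' x')
    (h0 : c 0 ≤ 0) (h1 : 0 < c 1) (h0' : c' 0 ≤ 0) (h1' : 0 < c' 1) :
    c 0 = c' 0 ∧ x = x' := by
  have R := h _ _ _ _ hp hp'
  have R' := h _ _ _ _ hp' hp
  have hm := hp.strictMono hσ
  have hm' := hp'.strictMono hσ
  have e0 : c 0 = c' 0 := by
    obtain ⟨l, hl, -⟩ := R 0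
    obtain ⟨l', hl', -⟩ := R' 0
    have b1 := hm'.lt_iff_lt.1 (show c' l < c' 1 by omega)
    have b2 := hm.lt_iff_lt.1 (show c l' < c 1 by omega)
    have b3 := hm'.le_iff_le.2 (show l ≤ 0 by omega)
    have b4 := hm.le_iff_le.2 (show l' ≤ 0 by omega)
    omega
  have ex : ∀ ℓ, c ℓ = c' ℓ → x ℓ = x' ℓ := by
    intro ℓ e
    obtain ⟨l, hl, hx⟩ := R ℓ
    have : l = ℓ := hm'.injective (by omega)
    subst this
    exact hx.symm
  have ec : ∀ ℓ, c ℓ = c' ℓ := by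
    intro ℓ
    induction ℓ using Int.induction_on with
    | zero => exact e0
    | succ n ih => rw [hp.step, hp'.step, ih, ex _ ih]
    | pred n ih =>
      obtain ⟨l, hl, -⟩ := R (-(n : ℤ) - 1)
      obtain ⟨l', hl', -⟩ := R' (-(n : ℤ) - 1)
      have a1 := hm (show -(n : ℤ) - 1 < -n by omega)
      have a2 := hm' (show -(n : ℤ) - 1 < -n by omega)
      have b1 := hm'.lt_iff_lt.1 (show c' l < c' (-n) by omega)
      have b2 := hm.lt_iff_lt.1 (show c l' < c (-n) by omega)
      have b3 := hm'.le_iff_le.2 (show l ≤ -(n : ℤ) - 1 by omega)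
      have b4 := hm.le_iff_le.2 (show l' ≤ -(n : ℤ) - 1 by omega)
      omega
  exact ⟨e0, funext fun ℓ => ex ℓ (ec ℓ)⟩

theorem recInAp_of_recP {σ : A → List B} (hσ : NonErasing σ)
    (h : ∀ y : ℤ → B, Aperiodic y → RecP σ y) (X : Set (ℤ → A)) : RecInAp σ X := by
  intro y hy k k' x x' _ _ ⟨hr, h0, h1⟩ ⟨hr', h0', h1'⟩
  have z0 : ∀ x : ℤ → A, cut σ x 0 = 0 := fun x => by simp [cut]
  have z1 : ∀ x : ℤ → A, cut σ x 1 = (σ (x 0)).length := fun x => by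
    have := cut_succ σ x 0
    rw [z0] at this
    simpa using this
  have q := parse_eq hσ (h y hy) hr.parse hr'.parse (by simp only [z0]; omega)
    (by simp only [z1]; omega) (by simp only [z0]; omega) (by simp only [z1]; omega)
  simp only [z0] at q
  exact ⟨by omega, q.2⟩

end Final

end Recog

open Recog in
/-- A directive sequence whose morphisms each have full-rank incidence matrix,
or a two-letter domain alphabet, or are rotationally conjugate to a left or right
permutative morphism, is recognizable for aperiodic points. -/
theorem stmt1 {𝒜 : ℕ → Type*} [∀ n, Fintype (𝒜 n)] [∀ n, DecidableEq (𝒜 n)]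
    (σ : ∀ n, 𝒜 (n + 1) → List (𝒜 n)) (hσ : ∀ n, NonErasing (σ n))
    (hcond : ∀ n, (incidence (σ n)).rank = Fintype.card (𝒜 (n + 1)) ∨
      Fintype.card (𝒜 (n + 1)) = 2 ∨
      ∃ σ' : 𝒜 (n + 1) → List (𝒜 n), NonErasing σ' ∧ RotConj (σ n) σ' ∧
        (LeftPermutative σ' ∨ RightPermutative σ')) :
    ∀ n : ℕ, RecInAp (σ n) (sadicX σ (n + 1)) := by
  exact fun n => recInAp_of_recP (hσ n) (fun _ hy => recP_main (hσ n) (hcond n) hy) _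
end
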